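/- arXiv:2004.03651 — 2 statements merged into one kernel-verified Lean document; each statement's English description precedes it below -/
import Mathlib

section
/- Let 𝒳,𝒴,𝒵,𝒲 be finite alphabets, p_{XYZ} a PMF on 𝒳×𝒴×𝒵, and p_{WXYZ} a PMF on 𝒲×𝒳×𝒴×𝒵 whose 𝒳×𝒴×𝒵-marginal equals p_{XYZ} and for which Z−X−W and X−(Z,W)−Y are Markov chains. If nonnegative reals R, C and a real R̃ satisfy R̃ ≥ I(X;W), R̃ − R ≤ I(W;Z), and R̃ + C ≥ I(X,Y,Z;W) (mutual informations computed under p_{WXYZ}), then (R,C) ∈ ℛ_s(p_{XYZ}). -/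
open scoped BigOperators Classical

noncomputable section

/-- A probability mass function on a finite type, represented as a real-valued function. -/
def IsPMF {α : Type*} [Fintype α] (p : α → ℝ) : Prop :=
  (∀ a, 0 ≤ p a) ∧ ∑ a, p a = 1

/-- Pushforward (marginal/image distribution) of `p` along `f`. -/
def push {α β : Type*} [Fintype α] (p : α → ℝ) (f : α → β) : β → ℝ :=
  fun b => ∑ a, if f a = b then p a else 0

/-- Shannon entropy (base 2) of a PMF, with the convention `0 * log 0 = 0`. -/
def Hent {α : Type*} [Fintype α] (p : α → ℝ) : ℝ :=
  ∑ a, -(p a * Real.logb 2 (p a))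

/-- Mutual information `I(A;B)` of a joint PMF on `α × β`. -/
def I2 {α β : Type*} [Fintype α] [Fintype β] (p : α × β → ℝ) : ℝ :=
  Hent (push p Prod.fst) + Hent (push p Prod.snd) - Hent p

/-- Conditional mutual information `I(A;B|C)` of a joint PMF on `α × β × γ`,
computed as `H(A,C) + H(B,C) - H(A,B,C) - H(C)`. -/
def CI {α β γ : Type*} [Fintype α] [Fintype β] [Fintype γ]
    (p : α × β × γ → ℝ) : ℝ :=
  Hent (push p (fun x => (x.1, x.2.2))) + Hent (push p Prod.snd)
    - Hent p - Hent (push p (fun x => x.2.2))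

/-- Markov chain `A − B − C` for a joint PMF on `α × β × γ`:
`A` and `C` are conditionally independent given `B`, i.e.
`p(a,b,c) p(b) = p(a,b) p(b,c)` for all `a, b, c`. -/
def Markov {α β γ : Type*} [Fintype α] [Fintype β] [Fintype γ]
    (p : α × β × γ → ℝ) : Prop :=
  ∀ a b c, p (a, b, c) * push p (fun x => x.2.1) b
    = push p (fun x => (x.1, x.2.1)) (a, b) * push p Prod.snd (b, c)

/-- Total variation distance `‖p − q‖₁ = (1/2) Σ |p a − q a|`. -/
def tvDist {α : Type*} [Fintype α] (p q : α → ℝ) : ℝ :=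
  (1 / 2) * ∑ a, |p a - q a|

/-- `⌈2^{nC}⌉`. -/
def NC (n : ℕ) (C : ℝ) : ℕ := ⌈(2 : ℝ) ^ ((n : ℝ) * C)⌉₊

/-- `(R,C)` is achievable for the channel-synthesis-with-side-information problem
for the PMF `p` on `𝒳 × 𝒴 × 𝒵` (Definition 1 of the paper): for every `ε > 0` and all
sufficiently large `n` there are a message alphabet `[Θ]` of rate at most `R + ε`,
`⌈2^{nC}⌉` randomized encoders `𝒳^n → [Θ]` and randomized decoders `𝒵^n × [Θ] → 𝒴^n`
whose induced joint PMF is `ε`-close in total variation to the `n`-fold product of `p`. -/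
def RsAchievable {X Y Z : Type} [Fintype X] [Fintype Y] [Fintype Z]
    (p : X × Y × Z → ℝ) (R C : ℝ) : Prop :=
  ∀ ε : ℝ, 0 < ε → ∃ N : ℕ, ∀ n : ℕ, N ≤ n →
    ∃ Θ : ℕ,
      (1 / (n : ℝ)) * Real.logb 2 (Θ : ℝ) ≤ R + ε ∧
      ∃ enc : Fin (NC n C) → (Fin n → X) → Fin Θ → ℝ,
        ∃ dec : Fin (NC n C) → (Fin n → Z) → Fin Θ → (Fin n → Y) → ℝ,
          (∀ μ xn, IsPMF (enc μ xn)) ∧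
          (∀ μ zn m, IsPMF (dec μ zn m)) ∧
          tvDist
            (fun w : (Fin n → X) × (Fin n → Y) × (Fin n → Z) =>
              ∏ i, p (w.1 i, w.2.1 i, w.2.2 i))
            (fun w : (Fin n → X) × (Fin n → Y) × (Fin n → Z) =>
              (NC n C : ℝ)⁻¹ * ∑ μ : Fin (NC n C), ∑ m : Fin Θ,
                (∏ i, push p (fun v => (v.1, v.2.2)) (w.1 i, w.2.2 i)) *
                  enc μ w.1 m * dec μ w.2.2 m w.2.1) ≤ ε

section Codebook

variable {W J ι : Type*} [Fintype W] [Fintype J] [DecidableEq J] [Fintype ι]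

/-- Expectation of `F` over a random codebook `c : J → W` with i.i.d. codewords of law `Q`. -/
def codeMean (Q : W → ℝ) (F : (J → W) → ℝ) : ℝ :=
  ∑ c : J → W, (∏ j, Q (c j)) * F c

theorem codeMean_prod (Q : W → ℝ) (g : J → W → ℝ) :
    codeMean Q (fun c => ∏ j, g j (c j)) = ∏ j, ∑ w, Q w * g j w := by
  rw [Finset.prod_univ_sum, Fintype.piFinset_univ]
  simp only [codeMean, Finset.prod_mul_distrib]

theorem codeMean_apply {Q : W → ℝ} (hQ : IsPMF Q) (f : W → ℝ) (j : J) :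
    codeMean Q (fun c => f (c j)) = ∑ w, Q w * f w := by
  have h := codeMean_prod Q (fun (k : J) w => if k = j then f w else 1)
  have hk : ∀ k : J, ∑ w, Q w * (if k = j then f w else 1)
      = if k = j then ∑ w, Q w * f w else 1 := by
    intro k
    split_ifs <;> simp [hQ.2]
  rw [Finset.prod_congr rfl fun k _ => hk k] at h
  simpa using h

theorem codeMean_mul {Q : W → ℝ} (hQ : IsPMF Q) (f g : W → ℝ) {i j : J} (hij : i ≠ j) :
    codeMean Q (fun c => f (c i) * g (c j)) = (∑ w, Q w * f w) * ∑ w, Q w * g w := by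
  have h := codeMean_prod Q
    (fun (k : J) w => (if k = i then f w else 1) * (if k = j then g w else 1))
  have hk : ∀ k : J, ∑ w, Q w * ((if k = i then f w else 1) * (if k = j then g w else 1))
      = (if k = i then ∑ w, Q w * f w else 1) * (if k = j then ∑ w, Q w * g w else 1) := by
    intro k
    by_cases h1 : k = i
    · have h2 : k ≠ j := fun h2 => hij (h1.symm.trans h2)
      simp [h1, hij]
    · by_cases h2 : k = j
      · simp [h2, hij.symm]
      · simp [h1, h2, hQ.2]
  rw [Finset.prod_congr rfl fun k _ => hk k] at h
  simpa only [Finset.prod_mul_distrib, Finset.prod_ite_eq', Finset.mem_univ, if_true] using h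

theorem codeMean_add (Q : W → ℝ) (F G : (J → W) → ℝ) :
    codeMean Q (fun c => F c + G c) = codeMean Q F + codeMean Q G := by
  simp only [codeMean, mul_add, Finset.sum_add_distrib]

theorem codeMean_const_mul (Q : W → ℝ) (r : ℝ) (F : (J → W) → ℝ) :
    codeMean Q (fun c => r * F c) = r * codeMean Q F := by
  simp only [codeMean, Finset.mul_sum]
  exact Finset.sum_congr rfl fun c _ => by ring

theorem codeMean_sum {κ : Type*} (s : Finset κ) (Q : W → ℝ) (F : κ → (J → W) → ℝ) :
    codeMean Q (fun c => ∑ k ∈ s, F k c) = ∑ k ∈ s, codeMean Q (F k) := by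
  simp only [codeMean, Finset.mul_sum]
  exact Finset.sum_comm

theorem codeMean_mono {Q : W → ℝ} (hQ : IsPMF Q) {F G : (J → W) → ℝ} (h : ∀ c, F c ≤ G c) :
    codeMean Q F ≤ codeMean Q G :=
  Finset.sum_le_sum fun c _ =>
    mul_le_mul_of_nonneg_left (h c) (Finset.prod_nonneg fun j _ => hQ.1 (c j))

theorem sum_codeWeight {Q : W → ℝ} (hQ : IsPMF Q) : ∑ c : J → W, ∏ j, Q (c j) = 1 := by
  have h := codeMean_prod Q (fun (_ : J) _ => (1 : ℝ))
  simpa [codeMean, hQ.2] using h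

theorem codeMean_const {Q : W → ℝ} (hQ : IsPMF Q) (r : ℝ) :
    codeMean Q (fun _ : J → W => r) = r := by
  rw [codeMean, ← Finset.sum_mul, sum_codeWeight hQ, one_mul]

theorem exists_le_codeMean {Q : W → ℝ} (hQ : IsPMF Q) (F : (J → W) → ℝ) :
    ∃ c, F c ≤ codeMean Q F := by
  by_contra! h
  have hw : ∀ c : J → W, 0 ≤ ∏ j, Q (c j) := fun c => Finset.prod_nonneg fun j _ => hQ.1 (c j)
  obtain ⟨c, -, hc⟩ : ∃ c ∈ (Finset.univ : Finset (J → W)), ∏ j, Q (c j) ≠ 0 :=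
    Finset.exists_ne_zero_of_sum_ne_zero (by rw [sum_codeWeight (J := J) hQ]; exact one_ne_zero)
  have : codeMean Q (fun _ : J → W => codeMean Q F) < codeMean Q F :=
    Finset.sum_lt_sum (fun (c : J → W) _ => mul_le_mul_of_nonneg_left (h c).le (hw c))
      ⟨c, Finset.mem_univ c, mul_lt_mul_of_pos_left (h c) (lt_of_le_of_ne (hw c) hc.symm)⟩
  rw [codeMean_const hQ] at this
  exact lt_irrefl _ this

theorem exists_add_add_le {Q : W → ℝ} (hQ : IsPMF Q) {F G H : (J → W) → ℝ} {x y z : ℝ}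
    (hF : codeMean Q F ≤ x) (hG : codeMean Q G ≤ y) (hH : codeMean Q H ≤ z) :
    ∃ c, F c + G c + H c ≤ x + y + z := by
  obtain ⟨c, hc⟩ := exists_le_codeMean hQ (fun c => F c + G c + H c)
  refine ⟨c, hc.trans ?_⟩
  rw [codeMean_add, codeMean_add]
  exact add_le_add (add_le_add hF hG) hH

theorem codeMean_average_le {κ : Type*} [Fintype κ] [Nonempty κ] {Q : W → ℝ}
    {F : κ → (J → W) → ℝ} {r : ℝ} (h : ∀ k, codeMean Q (F k) ≤ r) :
    codeMean Q (fun c => (Fintype.card κ : ℝ)⁻¹ * ∑ k, F k c) ≤ r := by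
  have hκ : (0 : ℝ) < Fintype.card κ := by exact_mod_cast Fintype.card_pos
  rw [codeMean_const_mul, codeMean_sum, inv_mul_le_iff₀ hκ]
  refine (Finset.sum_le_sum fun k _ => h k).trans (le_of_eq ?_)
  simp

theorem codeMean_abs_sq_le {Q : W → ℝ} (hQ : IsPMF Q) (F : (J → W) → ℝ) :
    codeMean Q (fun c => |F c|) ^ 2 ≤ codeMean Q (fun c => F c ^ 2) := by
  have hw : ∀ c : J → W, 0 ≤ ∏ j, Q (c j) := fun c => Finset.prod_nonneg fun j _ => hQ.1 (c j)
  have h := Finset.sum_sq_le_sum_mul_sum_of_sq_le_mul (Finset.univ : Finset (J → W))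
    (r := fun c => (∏ j, Q (c j)) * |F c|) (f := fun c => ∏ j, Q (c j))
    (g := fun c => (∏ j, Q (c j)) * F c ^ 2) (fun c _ => hw c)
    (fun c _ => mul_nonneg (hw c) (sq_nonneg _))
    (fun c _ => by rw [mul_pow, sq_abs]; exact le_of_eq (by ring))
  rwa [sum_codeWeight hQ, one_mul] at h

theorem codeMean_sq_sum_of_centered {Q : W → ℝ} (hQ : IsPMF Q) {φ : ι → J}
    (hφ : Function.Injective φ) (g : W → ℝ) (hg : ∑ w, Q w * g w = 0) :
    codeMean Q (fun c => (∑ i, g (c (φ i))) ^ 2)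
      = Fintype.card ι * ∑ w, Q w * g w ^ 2 := by
  simp only [sq, Finset.sum_mul_sum]
  rw [codeMean_sum]
  have : ∀ i : ι, codeMean Q (fun c : J → W => ∑ k, g (c (φ i)) * g (c (φ k)))
      = ∑ w, Q w * (g w * g w) := by
    intro i
    rw [codeMean_sum, Finset.sum_eq_single i]
    · exact codeMean_apply hQ (fun w => g w * g w) (φ i)
    · intro k _ hk
      rw [codeMean_mul hQ g g (fun h => hk (hφ h).symm), hg, zero_mul]
    · simp
  simp [this]

theorem codeMean_abs_average_sub_le [Nonempty ι] {Q : W → ℝ} (hQ : IsPMF Q) {φ : ι → J}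
    (hφ : Function.Injective φ) (h : W → ℝ) :
    codeMean Q (fun c => |(Fintype.card ι : ℝ)⁻¹ * ∑ i, h (c (φ i)) - ∑ w, Q w * h w|)
      ≤ √((Fintype.card ι : ℝ)⁻¹ * ∑ w, Q w * h w ^ 2) := by
  set m := ∑ w, Q w * h w with hm
  have hM : (Fintype.card ι : ℝ) ≠ 0 := by exact_mod_cast Fintype.card_ne_zero
  have hcent : ∑ w, Q w * (h w - m) = 0 := by
    simp only [mul_sub, Finset.sum_sub_distrib, ← Finset.sum_mul, hQ.2]
    rw [← hm]; ring
  have hvar : ∑ w, Q w * (h w - m) ^ 2 ≤ ∑ w, Q w * h w ^ 2 := by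
    have : ∑ w, Q w * (h w - m) ^ 2 = ∑ w, Q w * h w ^ 2 - m ^ 2 := by
      have e : ∀ w, Q w * (h w - m) ^ 2 = Q w * h w ^ 2 - 2 * m * (Q w * h w) + Q w * m ^ 2 :=
        fun w => by ring
      simp only [e, Finset.sum_add_distrib, Finset.sum_sub_distrib, ← Finset.mul_sum,
        ← Finset.sum_mul, hQ.2, ← hm]
      ring
    rw [this]
    linarith [sq_nonneg m]
  have havg : ∀ c : J → W, (Fintype.card ι : ℝ)⁻¹ * ∑ i, h (c (φ i)) - m
      = (Fintype.card ι : ℝ)⁻¹ * ∑ i, (h (c (φ i)) - m) := by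
    intro c
    simp only [Finset.sum_sub_distrib, Finset.sum_const, Finset.card_univ, nsmul_eq_mul]
    field_simp
  apply Real.le_sqrt_of_sq_le
  refine (codeMean_abs_sq_le hQ _).trans ?_
  simp only [havg, mul_pow]
  rw [codeMean_const_mul, codeMean_sq_sum_of_centered hQ hφ (fun w => h w - m) hcent]
  calc _ = (Fintype.card ι : ℝ)⁻¹ * ∑ w, Q w * (h w - m) ^ 2 := by field_simp
    _ ≤ _ := by gcongr

theorem codeMean_abs_average_sub_le_two_mul [Nonempty ι] {Q : W → ℝ} (hQ : IsPMF Q) (φ : ι → J)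
    (h : W → ℝ) (hh : ∀ w, 0 ≤ h w) :
    codeMean Q (fun c => |(Fintype.card ι : ℝ)⁻¹ * ∑ i, h (c (φ i)) - ∑ w, Q w * h w|)
      ≤ 2 * ∑ w, Q w * h w := by
  have hm : 0 ≤ ∑ w, Q w * h w := Finset.sum_nonneg fun w _ => mul_nonneg (hQ.1 w) (hh w)
  have hM : (Fintype.card ι : ℝ) ≠ 0 := by exact_mod_cast Fintype.card_ne_zero
  have hle : ∀ c : J → W, |(Fintype.card ι : ℝ)⁻¹ * ∑ i, h (c (φ i)) - ∑ w, Q w * h w|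
      ≤ (Fintype.card ι : ℝ)⁻¹ * ∑ i, h (c (φ i)) + ∑ w, Q w * h w := by
    intro c
    have : 0 ≤ (Fintype.card ι : ℝ)⁻¹ * ∑ i, h (c (φ i)) :=
      mul_nonneg (by positivity) (Finset.sum_nonneg fun i _ => hh _)
    rw [abs_le]
    constructor <;> linarith
  refine (codeMean_mono hQ hle).trans ?_
  rw [codeMean_add, codeMean_const hQ, codeMean_const_mul, codeMean_sum]
  simp only [codeMean_apply hQ h, Finset.sum_const, Finset.card_univ, nsmul_eq_mul]
  rw [inv_mul_cancel_left₀ hM]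
  linarith

/-- Soft covering: the output law of a random codebook is close to the i.i.d. output law. -/
theorem codeMean_softCovering [Nonempty ι] {A : Type*} [Fintype A] {Q : W → ℝ} (hQ : IsPMF Q)
    {φ : ι → J} (hφ : Function.Injective φ) {V : W → A → ℝ} (hV : ∀ w, IsPMF (V w))
    {T : ℝ} (hT : 0 ≤ T) :
    codeMean Q (fun c => ∑ a, |(Fintype.card ι : ℝ)⁻¹ * ∑ i, V (c (φ i)) a - ∑ w, Q w * V w a|)
      ≤ 2 * ∑ w, ∑ a, (if T * ∑ w', Q w' * V w' a < V w a then Q w * V w a else 0)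
        + √(T / Fintype.card ι) := by
  set M : ℝ := (Fintype.card ι : ℝ) with hMdef
  have hM : 0 < M := by
    rw [hMdef]
    exact_mod_cast Fintype.card_pos
  set o : A → ℝ := fun a => ∑ w, Q w * V w a with ho
  have ho0 : ∀ a, 0 ≤ o a := fun a =>
    Finset.sum_nonneg fun w _ => mul_nonneg (hQ.1 w) ((hV w).1 a)
  have ho1 : ∑ a, o a = 1 := by
    rw [Finset.sum_comm]
    simp only [← Finset.mul_sum, (hV _).2, mul_one, hQ.2]
  set V1 : W → A → ℝ := fun w a => if T * o a < V w a then 0 else V w a with hV1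
  set V2 : W → A → ℝ := fun w a => if T * o a < V w a then V w a else 0 with hV2
  have hsplit : ∀ w a, V w a = V1 w a + V2 w a := by
    intro w a
    simp only [hV1, hV2]
    split_ifs <;> simp
  have hpt : ∀ a, codeMean Q (fun c : J → W => |M⁻¹ * ∑ i, V (c (φ i)) a - o a|)
      ≤ o a * √(T / M) + 2 * ∑ w, Q w * V2 w a := by
    intro a
    have h1 := codeMean_abs_average_sub_le hQ hφ (fun w => V1 w a)
    have h2 := codeMean_abs_average_sub_le_two_mul hQ φ (fun w => V2 w a) (fun w => by
      simp only [hV2]; split_ifs; exacts [(hV w).1 a, le_rfl])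
    have h3 : √(M⁻¹ * ∑ w, Q w * V1 w a ^ 2) ≤ o a * √(T / M) := by
      rw [← Real.sqrt_sq (ho0 a), ← Real.sqrt_mul (sq_nonneg _)]
      apply Real.sqrt_le_sqrt
      have : ∑ w, Q w * V1 w a ^ 2 ≤ ∑ w, T * o a * (Q w * V w a) := by
        refine Finset.sum_le_sum fun w _ => ?_
        simp only [hV1]
        split_ifs with hlt
        · have := mul_nonneg (mul_nonneg hT (ho0 a)) (mul_nonneg (hQ.1 w) ((hV w).1 a))
          simpa using this
        · have := mul_le_mul_of_nonneg_right (not_lt.mp hlt)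
            (mul_nonneg (hQ.1 w) ((hV w).1 a))
          nlinarith
      rw [← Finset.mul_sum] at this
      calc M⁻¹ * ∑ w, Q w * V1 w a ^ 2 ≤ M⁻¹ * (T * o a * o a) := by gcongr
        _ = o a ^ 2 * (T / M) := by field_simp
    refine le_trans ?_ (add_le_add (h1.trans h3) h2)
    rw [← codeMean_add]
    refine codeMean_mono hQ fun c => ?_
    refine le_trans (le_of_eq ?_) (abs_add_le _ _)
    congr 1
    simp only [ho, hsplit, mul_add, Finset.sum_add_distrib]
    ring
  rw [codeMean_sum]
  refine (Finset.sum_le_sum fun a _ => hpt a).trans ?_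
  rw [Finset.sum_add_distrib, ← Finset.sum_mul, ho1, one_mul, ← Finset.mul_sum, Finset.sum_comm,
    add_comm]
  refine le_of_eq ?_
  congr 2
  refine Finset.sum_congr rfl fun w _ => Finset.sum_congr rfl fun a _ => ?_
  simp only [hV2, ho, mul_ite, mul_zero]

end Codebook

section OneShot

theorem exists_isPMF_sum_mul_eq {ι : Type*} [Fintype ι] [Nonempty ι] (f : ι → ℝ)
    (hf : ∀ i, 0 ≤ f i) : ∃ g : ι → ℝ, IsPMF g ∧ ∀ i, (∑ k, f k) * g i = f i := by
  by_cases h : ∑ k, f k = 0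
  · obtain ⟨i₀⟩ := ‹Nonempty ι›
    refine ⟨fun i => if i = i₀ then 1 else 0, ⟨fun i => ?_, by simp⟩, fun i => ?_⟩
    · dsimp only
      split_ifs <;> norm_num
    · rw [h, zero_mul]
      exact ((Finset.sum_eq_zero_iff_of_nonneg fun k _ => hf k).mp h i (Finset.mem_univ i)).symm
  · refine ⟨fun i => f i / ∑ k, f k,
      ⟨fun i => div_nonneg (hf i) (Finset.sum_nonneg fun k _ => hf k), ?_⟩, fun i => ?_⟩
    · rw [← Finset.sum_div, div_self h]
    · field_simp

theorem IsPMF.le_one {α : Type*} [Fintype α] {p : α → ℝ} (hp : IsPMF p) (a : α) : p a ≤ 1 :=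
  hp.2 ▸ Finset.single_le_sum (fun i _ => hp.1 i) (Finset.mem_univ a)

theorem IsPMF.mixture {ι α : Type*} [Fintype ι] [Fintype α] {g : ι → ℝ} {d : ι → α → ℝ}
    (hg : IsPMF g) (hd : ∀ i, IsPMF (d i)) : IsPMF fun a => ∑ i, g i * d i a := by
  refine ⟨fun a => Finset.sum_nonneg fun i _ => mul_nonneg (hg.1 i) ((hd i).1 a), ?_⟩
  rw [Finset.sum_comm]
  simp only [← Finset.mul_sum, (hd _).2, mul_one, hg.2]

theorem sum_abs_mixture_sub_le {ι α : Type*} [Fintype ι] [Fintype α] {g : ι → ℝ} {d : ι → α → ℝ}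
    (hg : IsPMF g) (hd : ∀ i, IsPMF (d i)) (i₀ : ι) :
    ∑ a, |∑ i, g i * d i a - d i₀ a| ≤ 2 * (1 - g i₀) := by
  have h1 : ∀ a, |∑ i, g i * d i a - d i₀ a| ≤ ∑ i, g i * |d i a - d i₀ a| := by
    intro a
    have : ∑ i, g i * d i a - d i₀ a = ∑ i, g i * (d i a - d i₀ a) := by
      simp only [mul_sub, Finset.sum_sub_distrib, ← Finset.sum_mul, hg.2, one_mul]
    rw [this]
    refine (Finset.abs_sum_le_sum_abs _ _).trans (le_of_eq ?_)
    exact Finset.sum_congr rfl fun i _ => by rw [abs_mul, abs_of_nonneg (hg.1 i)]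
  have h2 : ∀ i, ∑ a, g i * |d i a - d i₀ a| ≤ if i = i₀ then 0 else 2 * g i := by
    intro i
    split_ifs with h
    · simp [h]
    · rw [← Finset.mul_sum, mul_comm 2]
      refine mul_le_mul_of_nonneg_left ?_ (hg.1 i)
      calc ∑ a, |d i a - d i₀ a| ≤ ∑ a, (d i a + d i₀ a) := by
            refine Finset.sum_le_sum fun a _ => ?_
            have := (hd i).1 a
            have := (hd i₀).1 a
            rw [abs_le]
            constructor <;> linarith
        _ = 2 := by rw [Finset.sum_add_distrib, (hd i).2, (hd i₀).2]; norm_num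
  calc _ ≤ ∑ a, ∑ i, g i * |d i a - d i₀ a| := Finset.sum_le_sum fun a _ => h1 a
    _ = ∑ i, ∑ a, g i * |d i a - d i₀ a| := Finset.sum_comm
    _ ≤ ∑ i, if i = i₀ then 0 else 2 * g i := Finset.sum_le_sum fun i _ => h2 i
    _ = ∑ i, (2 * g i - if i = i₀ then 2 * g i else 0) := by
        refine Finset.sum_congr rfl fun i _ => ?_
        split_ifs <;> simp
    _ = 2 * (1 - g i₀) := by
        rw [Finset.sum_sub_distrib, ← Finset.mul_sum, hg.2]
        simp only [Finset.sum_ite_eq', Finset.mem_univ, if_true]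
        ring

theorem isPMF_tripleKernel {X Y Z : Type*} [Fintype X] [Fintype Y] [Fintype Z] {a : X → ℝ}
    {b : X → Z → ℝ}
    {d : Z → Y → ℝ} (ha : IsPMF a) (hb : ∀ x, IsPMF (b x)) (hd : ∀ z, IsPMF (d z)) :
    IsPMF fun v : X × Y × Z => a v.1 * b v.1 v.2.2 * d v.2.2 v.2.1 := by
  refine ⟨fun v => mul_nonneg (mul_nonneg (ha.1 _) ((hb _).1 _)) ((hd _).1 _), ?_⟩
  simp only [Fintype.sum_prod_type]
  have : ∀ x, ∑ y, ∑ z, a x * b x z * d z y = a x := by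
    intro x
    rw [Finset.sum_comm]
    simp only [← Finset.mul_sum, (hd _).2, mul_one, (hb _).2]
  simp only [this, ha.2]

variable {W X Y Z κ θ β : Type*} [Fintype X] [Fintype Y] [Fintype Z]
  [Fintype κ] [Fintype θ] [Fintype β] [DecidableEq β]

/-- For a fixed codebook, the likelihood encoder and the likelihood decoder simulate the target
law up to the sum of two resolvability errors and a decoding error. -/
theorem exists_codes_of_codebook [Nonempty θ] [Nonempty β]
    (c : κ × θ × β → W) {a : W → X → ℝ} {b : X → Z → ℝ} {d : W → Z → Y → ℝ}
    (ha : ∀ w, IsPMF (a w)) (hb : ∀ x, IsPMF (b x)) (hd : ∀ w z, IsPMF (d w z))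
    (pX : X → ℝ) (p : X × Y × Z → ℝ) :
    ∃ enc : κ → X → θ → ℝ, ∃ dec : κ → Z → θ → Y → ℝ,
      (∀ μ x, IsPMF (enc μ x)) ∧ (∀ μ z m, IsPMF (dec μ z m)) ∧
      ∑ v : X × Y × Z, |p v - (Fintype.card κ : ℝ)⁻¹ *
          ∑ μ, ∑ m, (pX v.1 * b v.1 v.2.2) * enc μ v.1 m * dec μ v.2.2 m v.2.1|
        ≤ (∑ v : X × Y × Z, |(Fintype.card (κ × θ × β) : ℝ)⁻¹ *
              ∑ i, a (c i) v.1 * b v.1 v.2.2 * d (c i) v.2.2 v.2.1 - p v|)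
          + (Fintype.card κ : ℝ)⁻¹ * (∑ μ, ∑ x,
              |(Fintype.card (θ × β) : ℝ)⁻¹ * ∑ i, a (c (μ, i)) x - pX x|)
          + 2 * ((Fintype.card (κ × θ × β) : ℝ)⁻¹ * ∑ i : κ × θ × β, ∑ z,
              min (∑ x, a (c i) x * b x z)
                (∑ j ∈ Finset.univ.erase i.2.2, ∑ x, a (c (i.1, i.2.1, j)) x * b x z)) := by
  set u : W → Z → ℝ := fun w z => ∑ x, a w x * b x z with hu
  have hu0 : ∀ w z, 0 ≤ u w z := fun w z =>
    Finset.sum_nonneg fun x _ => mul_nonneg ((ha w).1 x) ((hb x).1 z)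
  choose L hL hLa using fun (μ : κ) (x : X) =>
    exists_isPMF_sum_mul_eq (fun i : θ × β => a (c (μ, i)) x) (fun i => (ha _).1 x)
  choose G hG hGu using fun (μ : κ) (z : Z) (m : θ) =>
    exists_isPMF_sum_mul_eq (fun j : β => u (c (μ, m, j)) z) (fun j => hu0 _ z)
  set enc : κ → X → θ → ℝ := fun μ x m => ∑ j, L μ x (m, j) with henc
  set dec : κ → Z → θ → Y → ℝ := fun μ z m y => ∑ j, G μ z m j * d (c (μ, m, j)) z y with hdec
  have henc' : ∀ μ x, IsPMF (enc μ x) := fun μ x =>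
    ⟨fun m => Finset.sum_nonneg fun j _ => (hL μ x).1 _, by
      rw [← (hL μ x).2, Fintype.sum_prod_type]⟩
  have hdec' : ∀ μ z m, IsPMF (dec μ z m) := fun μ z m =>
    (hG μ z m).mixture fun j => hd _ z
  refine ⟨enc, dec, henc', hdec', ?_⟩
  set k : ℝ := (Fintype.card κ : ℝ)⁻¹ with hk
  set N : ℝ := (Fintype.card (θ × β) : ℝ)⁻¹ with hN
  have hk0 : 0 ≤ k := by positivity
  have hN0 : 0 ≤ N := by positivity
  have hkN : (Fintype.card (κ × θ × β) : ℝ)⁻¹ = k * N := by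
    rw [Fintype.card_prod κ (θ × β), Nat.cast_mul, mul_inv]
  rw [hkN]
  set P2 : X × Y × Z → ℝ := fun v =>
    k * N * ∑ i, a (c i) v.1 * b v.1 v.2.2 * d (c i) v.2.2 v.2.1 with hP2
  set D : κ → X × Y × Z → ℝ := fun μ v => b v.1 v.2.2 * ∑ m, enc μ v.1 m * dec μ v.2.2 m v.2.1
    with hD
  set s : κ → X → ℝ := fun μ x => N * ∑ i, a (c (μ, i)) x with hs
  have hP : ∀ v : X × Y × Z,
      k * ∑ μ, ∑ m, (pX v.1 * b v.1 v.2.2) * enc μ v.1 m * dec μ v.2.2 m v.2.1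
        = k * ∑ μ, pX v.1 * D μ v := by
    intro v
    simp only [hD, Finset.mul_sum]
    refine Finset.sum_congr rfl fun μ _ => Finset.sum_congr rfl fun m _ => by ring
  have hP1 : ∀ v : X × Y × Z, k * ∑ μ, s μ v.1 * D μ v
      = k * N * ∑ i : κ × θ × β,
          a (c i) v.1 * b v.1 v.2.2 * dec i.1 v.2.2 i.2.1 v.2.1 := by
    intro v
    rw [Fintype.sum_prod_type, mul_assoc]
    congr 1
    rw [Finset.mul_sum]
    refine Finset.sum_congr rfl fun μ _ => ?_
    simp only [hs, hD, henc]
    rw [mul_assoc]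
    congr 1
    have hterm : ∀ m j, a (c (μ, (m, j))) v.1 * b v.1 v.2.2 * dec μ v.2.2 m v.2.1
        = (∑ i, a (c (μ, i)) v.1) * (b v.1 v.2.2 * (L μ v.1 (m, j) * dec μ v.2.2 m v.2.1)) := by
      intro m j
      rw [← hLa μ v.1 (m, j)]
      ring
    rw [Fintype.sum_prod_type (fun i : θ × β => a (c (μ, i)) v.1 * b v.1 v.2.2 *
      dec μ v.2.2 i.1 v.2.1)]
    simp only [hterm, ← Finset.mul_sum, ← Finset.sum_mul]
  have hD0 : ∀ μ v, 0 ≤ D μ v := fun μ v => mul_nonneg ((hb _).1 _)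
    (Finset.sum_nonneg fun m _ => mul_nonneg ((henc' _ _).1 _) ((hdec' _ _ _).1 _))
  have hD1 : ∀ μ x, ∑ y, ∑ z, D μ (x, y, z) = 1 := by
    intro μ x
    rw [Finset.sum_comm]
    have : ∀ z, ∑ y, D μ (x, y, z) = b x z := by
      intro z
      simp only [hD]
      rw [← Finset.mul_sum, Finset.sum_comm]
      simp only [← Finset.mul_sum, (hdec' _ _ _).2, mul_one, (henc' _ _).2]
    simp only [this, (hb x).2]
  have hboundA : ∑ v : X × Y × Z, |k * ∑ μ, s μ v.1 * D μ v - k * ∑ μ, pX v.1 * D μ v|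
      ≤ k * ∑ μ, ∑ x, |s μ x - pX x| := by
    calc _ ≤ ∑ v : X × Y × Z, k * ∑ μ, |s μ v.1 - pX v.1| * D μ v := by
          refine Finset.sum_le_sum fun v _ => ?_
          rw [← mul_sub, ← Finset.sum_sub_distrib, abs_mul, abs_of_nonneg hk0]
          refine mul_le_mul_of_nonneg_left ((Finset.abs_sum_le_sum_abs _ _).trans (le_of_eq ?_)) hk0
          refine Finset.sum_congr rfl fun μ _ => ?_
          rw [← sub_mul, abs_mul, abs_of_nonneg (hD0 μ v)]
      _ = k * ∑ μ, ∑ v : X × Y × Z, |s μ v.1 - pX v.1| * D μ v := by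
          rw [← Finset.mul_sum, Finset.sum_comm]
      _ = _ := by
          congr 1
          refine Finset.sum_congr rfl fun μ _ => ?_
          rw [Fintype.sum_prod_type]
          refine Finset.sum_congr rfl fun x _ => ?_
          dsimp only
          rw [← Finset.mul_sum, Fintype.sum_prod_type, hD1, mul_one]
  have hboundB : ∑ v : X × Y × Z, |P2 v - k * ∑ μ, s μ v.1 * D μ v|
      ≤ 2 * (k * N * ∑ i : κ × θ × β, ∑ z, min (u (c i) z)
          (∑ j ∈ Finset.univ.erase i.2.2, u (c (i.1, i.2.1, j)) z)) := by
    calc _ ≤ ∑ v : X × Y × Z, k * N * ∑ i : κ × θ × β, a (c i) v.1 * b v.1 v.2.2 *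
            |dec i.1 v.2.2 i.2.1 v.2.1 - d (c i) v.2.2 v.2.1| := by
          refine Finset.sum_le_sum fun v _ => ?_
          rw [hP1, hP2]
          dsimp only
          rw [← mul_sub, ← Finset.sum_sub_distrib, abs_mul, abs_of_nonneg (mul_nonneg hk0 hN0)]
          refine mul_le_mul_of_nonneg_left ((Finset.abs_sum_le_sum_abs _ _).trans (le_of_eq ?_))
            (mul_nonneg hk0 hN0)
          refine Finset.sum_congr rfl fun i _ => ?_
          rw [← mul_sub, abs_mul, abs_of_nonneg (mul_nonneg ((ha _).1 _) ((hb _).1 _)),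
            abs_sub_comm]
      _ = k * N * ∑ i : κ × θ × β, ∑ z, u (c i) z *
            ∑ y, |dec i.1 z i.2.1 y - d (c i) z y| := by
          rw [← Finset.mul_sum, Finset.sum_comm]
          congr 1
          refine Finset.sum_congr rfl fun i _ => ?_
          simp only [Fintype.sum_prod_type, hu, Finset.sum_mul]
          rw [Finset.sum_comm (s := (Finset.univ : Finset Z))]
          refine Finset.sum_congr rfl fun x _ => Finset.sum_comm.trans ?_
          simp only [Finset.mul_sum]
      _ ≤ k * N * ∑ i : κ × θ × β, ∑ z, 2 * min (u (c i) z)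
          (∑ j ∈ Finset.univ.erase i.2.2, u (c (i.1, i.2.1, j)) z) := by
          refine mul_le_mul_of_nonneg_left ?_ (mul_nonneg hk0 hN0)
          refine Finset.sum_le_sum fun i _ => Finset.sum_le_sum fun z _ => ?_
          obtain ⟨μ, m, j⟩ := i
          dsimp only
          have h1 := sum_abs_mixture_sub_le (hG μ z m) (fun j => hd (c (μ, m, j)) z) j
          have h2 := mul_le_mul_of_nonneg_left h1 (hu0 (c (μ, m, j)) z)
          refine h2.trans ?_
          have h3 := hGu μ z m j
          rw [← Finset.add_sum_erase _ _ (Finset.mem_univ j)] at h3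
          set S := ∑ j' ∈ Finset.univ.erase j, u (c (μ, m, j')) z with hS
          have hS0 : 0 ≤ S := Finset.sum_nonneg fun j _ => hu0 _ z
          have hg0 := (hG μ z m).1 j
          have hg1 := (hG μ z m).le_one j
          have hU := hu0 (c (μ, m, j)) z
          have : u (c (μ, m, j)) z * (1 - G μ z m j) ≤ min (u (c (μ, m, j)) z) S := by
            refine le_min ?_ ?_
            · nlinarith
            · nlinarith [mul_nonneg hS0 (sub_nonneg.mpr hg1)]
          linarith
      _ = _ := by
          simp only [← Finset.mul_sum]
          ring
  calc _ ≤ ∑ v : X × Y × Z, (|P2 v - p v| + |k * ∑ μ, s μ v.1 * D μ v - k * ∑ μ, pX v.1 * D μ v|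
          + |P2 v - k * ∑ μ, s μ v.1 * D μ v|) := by
        refine Finset.sum_le_sum fun v _ => ?_
        rw [hP]
        have h1 := abs_add_le (p v - P2 v) (P2 v - k * ∑ μ, s μ v.1 * D μ v)
        have h2 := abs_add_le (p v - P2 v + (P2 v - k * ∑ μ, s μ v.1 * D μ v))
          (k * ∑ μ, s μ v.1 * D μ v - k * ∑ μ, pX v.1 * D μ v)
        rw [abs_sub_comm (p v) (P2 v)] at h1
        have e : p v - P2 v + (P2 v - k * ∑ μ, s μ v.1 * D μ v)
          + (k * ∑ μ, s μ v.1 * D μ v - k * ∑ μ, pX v.1 * D μ v)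
          = p v - k * ∑ μ, pX v.1 * D μ v := by ring
        rw [e] at h2
        linarith
    _ ≤ _ := by
        rw [Finset.sum_add_distrib, Finset.sum_add_distrib]
        gcongr

/-- The mean pairwise decoding error of a random codebook. -/
theorem codeMean_decodingError [Fintype W] {J : Type*} [Fintype J] [DecidableEq J] {Q : W → ℝ}
    (hQ : IsPMF Q)
    {u : W → Z → ℝ} (hu : ∀ w, IsPMF (u w)) {τ : ℝ} (hτ : 0 < τ) (i : J) (s : Finset J)
    (hi : i ∉ s) :
    codeMean Q (fun c => ∑ z, min (u (c i) z) (∑ j ∈ s, u (c j) z))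
      ≤ ∑ w, ∑ z, (if u w z < τ * ∑ w', Q w' * u w' z then Q w * u w z else 0)
        + s.card / τ := by
  set o : Z → ℝ := fun z => ∑ w, Q w * u w z with ho
  have ho0 : ∀ z, 0 ≤ o z := fun z =>
    Finset.sum_nonneg fun w _ => mul_nonneg (hQ.1 w) ((hu w).1 z)
  have ho1 : ∑ z, o z = 1 := (hQ.mixture hu).2
  have hpt : ∀ z, codeMean Q (fun c : J → W => min (u (c i) z) (∑ j ∈ s, u (c j) z))
      ≤ ∑ w, (if u w z < τ * o z then Q w * u w z else 0) + o z * (s.card / τ) := by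
    intro z
    by_cases hz : o z = 0
    · refine (codeMean_mono hQ fun c => min_le_left _ _).trans ?_
      rw [codeMean_apply hQ (fun w => u w z), hz, zero_mul, add_zero]
      change o z ≤ _
      rw [hz]
      refine Finset.sum_nonneg fun w _ => ?_
      split_ifs
      exacts [mul_nonneg (hQ.1 w) ((hu w).1 z), le_rfl]
    · have hz0 : 0 < o z := lt_of_le_of_ne (ho0 z) (Ne.symm hz)
      have hle : ∀ c : J → W, min (u (c i) z) (∑ j ∈ s, u (c j) z)
          ≤ (if u (c i) z < τ * o z then u (c i) z else 0)
            + ∑ j ∈ s, (if u (c i) z < τ * o z then 0 else 1) * u (c j) z := by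
        intro c
        split_ifs with h
        · simp
        · simp
      refine (codeMean_mono hQ hle).trans ?_
      rw [codeMean_add, codeMean_apply hQ (fun w => if u w z < τ * o z then u w z else 0),
        codeMean_sum]
      have hmarkov : ∑ w, Q w * (if u w z < τ * o z then 0 else 1) ≤ τ⁻¹ := by
        have : ∀ w, Q w * (if u w z < τ * o z then 0 else 1) ≤ (τ * o z)⁻¹ * (Q w * u w z) := by
          intro w
          have h0 : 0 < τ * o z := mul_pos hτ hz0
          split_ifs with h
          · have := mul_nonneg (hQ.1 w) ((hu w).1 z)
            rw [mul_zero]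
            positivity
          · rw [inv_mul_eq_div, le_div_iff₀ h0, mul_one]
            exact mul_le_mul_of_nonneg_left (not_lt.mp h) (hQ.1 w)
        refine (Finset.sum_le_sum fun w _ => this w).trans (le_of_eq ?_)
        rw [← Finset.mul_sum]
        change (τ * o z)⁻¹ * o z = _
        field_simp
      have hterm : ∀ j ∈ s, codeMean Q
          (fun c : J → W => (if u (c i) z < τ * o z then 0 else 1) * u (c j) z) ≤ τ⁻¹ * o z := by
        intro j hj
        rw [codeMean_mul hQ (fun w => if u w z < τ * o z then 0 else 1) (fun w => u w z)
          (fun h : i = j => hi (h ▸ hj))]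
        exact mul_le_mul_of_nonneg_right hmarkov (ho0 z)
      refine add_le_add (le_of_eq ?_) ((Finset.sum_le_sum hterm).trans (le_of_eq ?_))
      · simp only [mul_ite, mul_zero]
      · rw [Finset.sum_const, nsmul_eq_mul]
        ring
  rw [codeMean_sum]
  refine (Finset.sum_le_sum fun z _ => hpt z).trans ?_
  rw [Finset.sum_add_distrib, ← Finset.sum_mul, ho1, one_mul, Finset.sum_comm]

/-- One-shot channel synthesis with side information, by random coding. -/
theorem exists_codes [Fintype W] [DecidableEq κ] [DecidableEq θ] [Nonempty κ] [Nonempty θ]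
    [Nonempty β] {Q : W → ℝ} {a : W → X → ℝ} {b : X → Z → ℝ} {d : W → Z → Y → ℝ}
    (hQ : IsPMF Q) (ha : ∀ w, IsPMF (a w)) (hb : ∀ x, IsPMF (b x)) (hd : ∀ w z, IsPMF (d w z))
    {T₁ T₂ τ : ℝ} (hT₁ : 0 ≤ T₁) (hT₂ : 0 ≤ T₂) (hτ : 0 < τ) :
    ∃ enc : κ → X → θ → ℝ, ∃ dec : κ → Z → θ → Y → ℝ,
      (∀ μ x, IsPMF (enc μ x)) ∧ (∀ μ z m, IsPMF (dec μ z m)) ∧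
      ∑ v : X × Y × Z, |∑ w, Q w * (a w v.1 * b v.1 v.2.2 * d w v.2.2 v.2.1) -
          (Fintype.card κ : ℝ)⁻¹ * ∑ μ, ∑ m,
            ((∑ w, Q w * a w v.1) * b v.1 v.2.2) * enc μ v.1 m * dec μ v.2.2 m v.2.1|
        ≤ (2 * ∑ w, ∑ v : X × Y × Z,
              (if T₂ * ∑ w', Q w' * (a w' v.1 * b v.1 v.2.2 * d w' v.2.2 v.2.1)
                  < a w v.1 * b v.1 v.2.2 * d w v.2.2 v.2.1
                then Q w * (a w v.1 * b v.1 v.2.2 * d w v.2.2 v.2.1) else 0)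
            + √(T₂ / Fintype.card (κ × θ × β)))
          + (2 * ∑ w, ∑ x, (if T₁ * ∑ w', Q w' * a w' x < a w x then Q w * a w x else 0)
            + √(T₁ / Fintype.card (θ × β)))
          + 2 * (∑ w, ∑ z, (if ∑ x, a w x * b x z < τ * ∑ w', Q w' * ∑ x, a w' x * b x z
                then Q w * ∑ x, a w x * b x z else 0)
            + ((Fintype.card β - 1 : ℕ) : ℝ) / τ) := by
  have hu : ∀ w, IsPMF fun z => ∑ x, a w x * b x z := fun w => (ha w).mixture hb
  have hv : ∀ w, IsPMF fun v : X × Y × Z => a w v.1 * b v.1 v.2.2 * d w v.2.2 v.2.1 :=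
    fun w => isPMF_tripleKernel (ha w) hb (hd w)
  have hcover := codeMean_softCovering hQ (J := κ × θ × β) (φ := id) Function.injective_id hv hT₂
  have henc : ∀ μ : κ, _ := fun μ => codeMean_softCovering hQ (J := κ × θ × β)
    (φ := fun i : θ × β => (μ, i)) (Prod.mk_right_injective μ) ha hT₁
  have hdec : ∀ i : κ × θ × β, _ := fun i => codeMean_decodingError hQ hu hτ i
    ((Finset.univ.erase i.2.2).image fun j => (i.1, i.2.1, j)) (by
      simp [Prod.ext_iff])
  have himage : ∀ (i : κ × θ × β) (f : κ × θ × β → ℝ),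
      ∑ j ∈ (Finset.univ.erase i.2.2).image (fun j => (i.1, i.2.1, j)), f j
        = ∑ j ∈ Finset.univ.erase i.2.2, f (i.1, i.2.1, j) := fun i f =>
    Finset.sum_image fun j _ j' _ h => by simpa using h
  have hcard : ∀ i : κ × θ × β,
      ((Finset.univ.erase i.2.2).image fun j => (i.1, i.2.1, j)).card = Fintype.card β - 1 := by
    intro i
    rw [Finset.card_image_of_injective _ (fun j j' h => by simpa using h),
      Finset.card_erase_of_mem (Finset.mem_univ _), Finset.card_univ]
  simp only [himage, hcard] at hdec
  have hdec2 := mul_le_mul_of_nonneg_left (codeMean_average_le hdec) (zero_le_two (α := ℝ))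
  rw [← codeMean_const_mul] at hdec2
  obtain ⟨c, hc⟩ := exists_add_add_le hQ hcover (codeMean_average_le henc) hdec2
  obtain ⟨enc, dec, h1, h2, h3⟩ := exists_codes_of_codebook c ha hb hd
    (fun x => ∑ w, Q w * a w x)
    (fun v => ∑ w, Q w * (a w v.1 * b v.1 v.2.2 * d w v.2.2 v.2.1))
  exact ⟨enc, dec, h1, h2, h3.trans hc⟩

end OneShot

section Tails

open Filter Topology

theorem exists_sum_mul_exp_lt_one {α : Type*} [Fintype α] {P : α → ℝ} (hP : IsPMF P) (l : α → ℝ)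
    (hl : ∑ x, P x * l x < 0) : ∃ s : ℝ, 0 < s ∧ ∑ x, P x * Real.exp (s * l x) < 1 := by
  have hder : HasDerivAt (fun s : ℝ => ∑ x, P x * Real.exp (s * l x)) (∑ x, P x * l x) 0 := by
    have : ∀ x ∈ (Finset.univ : Finset α),
        HasDerivAt (fun s : ℝ => P x * Real.exp (s * l x)) (P x * l x) 0 := by
      intro x _
      have h := (((hasDerivAt_id (0 : ℝ)).mul_const (l x)).exp).const_mul (P x)
      simpa using h
    exact HasDerivAt.fun_sum this
  have hslope := (hasDerivAt_iff_tendsto_slope.mp hder).eventually (Iio_mem_nhds hl)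
  have hslope' : ∀ᶠ s in 𝓝[>] (0 : ℝ),
      slope (fun s : ℝ => ∑ x, P x * Real.exp (s * l x)) 0 s < 0 :=
    hslope.filter_mono (nhdsWithin_mono _ fun s (hs : 0 < s) => hs.ne')
  obtain ⟨s, hs, hs0⟩ := (hslope'.and self_mem_nhdsWithin).exists
  refine ⟨s, hs0, ?_⟩
  rw [slope_def_field] at hs
  have hs0' : (0 : ℝ) < s := hs0
  by_contra! hge
  refine absurd hs (not_lt.mpr (div_nonneg ?_ (sub_nonneg.mpr hs0'.le)))
  simpa [hP.2] using hge

theorem tendsto_sum_prod_ite_nonneg {α : Type*} [Fintype α] {P : α → ℝ} (hP : IsPMF P)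
    (l : α → ℝ) (hl : ∑ x, P x * l x < 0) :
    Tendsto (fun n : ℕ => ∑ x : Fin n → α, if 0 ≤ ∑ i, l (x i) then ∏ i, P (x i) else 0)
      atTop (𝓝 0) := by
  obtain ⟨s, hs, hlt⟩ := exists_sum_mul_exp_lt_one hP l hl
  have h0 : 0 ≤ ∑ x, P x * Real.exp (s * l x) :=
    Finset.sum_nonneg fun x _ => mul_nonneg (hP.1 x) (Real.exp_pos _).le
  refine squeeze_zero (fun n => ?_) (fun n => ?_) (tendsto_pow_atTop_nhds_zero_of_lt_one h0 hlt)
  · refine Finset.sum_nonneg fun x _ => ?_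
    split_ifs
    exacts [Finset.prod_nonneg fun i _ => hP.1 _, le_rfl]
  · have : (∑ x, P x * Real.exp (s * l x)) ^ n
        = ∑ x : Fin n → α, (∏ i, P (x i)) * Real.exp (s * ∑ i, l (x i)) := by
      have h := Finset.prod_univ_sum (fun _ : Fin n => (Finset.univ : Finset α))
        (fun _ x => P x * Real.exp (s * l x))
      rw [Fintype.piFinset_univ, Finset.prod_const, Finset.card_univ, Fintype.card_fin] at h
      rw [h]
      refine Finset.sum_congr rfl fun x _ => ?_
      rw [Finset.prod_mul_distrib, Finset.mul_sum, Real.exp_sum]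
    rw [this]
    refine Finset.sum_le_sum fun x _ => ?_
    have hx : 0 ≤ ∏ i, P (x i) := Finset.prod_nonneg fun i _ => hP.1 _
    split_ifs with h
    · exact le_mul_of_one_le_right hx (Real.one_le_exp (mul_nonneg hs.le h))
    · exact mul_nonneg hx (Real.exp_pos _).le

variable {W A : Type*} [Fintype W]

theorem sum_prod_mul_prod_eq (n : ℕ) (Q : W → ℝ) (V : W → A → ℝ) (a : Fin n → A) :
    ∑ w : Fin n → W, (∏ i, Q (w i)) * ∏ i, V (w i) (a i) = ∏ i, ∑ w, Q w * V w (a i) := by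
  rw [Finset.prod_univ_sum, Fintype.piFinset_univ]
  simp only [Finset.prod_mul_distrib]

variable [Fintype A]

/-- Mutual information between input and output of the channel `V` with input law `Q`. -/
def channelInfo (Q : W → ℝ) (V : W → A → ℝ) : ℝ :=
  ∑ w, ∑ a, Q w * V w a * Real.logb 2 (V w a / ∑ w', Q w' * V w' a)

theorem isPMF_joint {Q : W → ℝ} {V : W → A → ℝ} (hQ : IsPMF Q) (hV : ∀ w, IsPMF (V w)) :
    IsPMF fun x : W × A => Q x.1 * V x.1 x.2 := by
  refine ⟨fun x => mul_nonneg (hQ.1 _) ((hV _).1 _), ?_⟩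
  rw [Fintype.sum_prod_type]
  simp only [← Finset.mul_sum, (hV _).2, mul_one, hQ.2]

theorem sum_joint_mul_log {Q : W → ℝ} {V : W → A → ℝ} (hQ : IsPMF Q) (hV : ∀ w, IsPMF (V w))
    (t : ℝ) :
    ∑ x : W × A, Q x.1 * V x.1 x.2 *
        (Real.log (V x.1 x.2 / ∑ w', Q w' * V w' x.2) - t * Real.log 2)
      = (channelInfo Q V - t) * Real.log 2 := by
  have h2 : Real.log 2 ≠ 0 := (Real.log_pos one_lt_two).ne'
  have h1 := (isPMF_joint hQ hV).2
  simp only [mul_sub, Finset.sum_sub_distrib, ← Finset.sum_mul, h1, one_mul, sub_mul]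
  congr 1
  rw [channelInfo, Fintype.sum_prod_type, Finset.sum_mul]
  refine Finset.sum_congr rfl fun w _ => ?_
  rw [Finset.sum_mul]
  refine Finset.sum_congr rfl fun a _ => ?_
  rw [Real.logb]
  field_simp

theorem pos_of_prod_ne_zero {Q : W → ℝ} {V : W → A → ℝ} (hQ : IsPMF Q) (hV : ∀ w, IsPMF (V w))
    {w : W} {a : A} (h : Q w * V w a ≠ 0) : 0 < V w a ∧ 0 < ∑ w', Q w' * V w' a := by
  have hpos : 0 < Q w * V w a := lt_of_le_of_ne (mul_nonneg (hQ.1 w) ((hV w).1 a)) h.symm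
  refine ⟨lt_of_le_of_ne ((hV w).1 a) (right_ne_zero_of_mul h).symm, hpos.trans_le ?_⟩
  exact Finset.single_le_sum (f := fun w' => Q w' * V w' a)
    (fun w' _ => mul_nonneg (hQ.1 w') ((hV w').1 a)) (Finset.mem_univ w)

theorem log_two_rpow_nat_mul (n : ℕ) (t : ℝ) :
    Real.log ((2 : ℝ) ^ ((n : ℝ) * t)) = ∑ _i : Fin n, t * Real.log 2 := by
  rw [Real.log_rpow two_pos]
  simp
  ring

theorem tendsto_infoDensity_upper {Q : W → ℝ} {V : W → A → ℝ} (hQ : IsPMF Q)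
    (hV : ∀ w, IsPMF (V w)) {t : ℝ} (ht : channelInfo Q V < t) :
    Tendsto (fun n : ℕ => ∑ w : Fin n → W, ∑ a : Fin n → A,
      if (2 : ℝ) ^ ((n : ℝ) * t) * ∑ w' : Fin n → W, (∏ i, Q (w' i)) * ∏ i, V (w' i) (a i)
          < ∏ i, V (w i) (a i)
        then (∏ i, Q (w i)) * ∏ i, V (w i) (a i) else 0) atTop (𝓝 0) := by
  have hl := sum_joint_mul_log hQ hV t
  have hneg : (channelInfo Q V - t) * Real.log 2 < 0 :=
    mul_neg_of_neg_of_pos (by linarith) (Real.log_pos one_lt_two)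
  rw [← hl] at hneg
  have h0 : ∀ (n : ℕ) (w : Fin n → W) (a : Fin n → A),
      0 ≤ (∏ i, Q (w i)) * ∏ i, V (w i) (a i) := fun n w a =>
    mul_nonneg (Finset.prod_nonneg fun i _ => hQ.1 _) (Finset.prod_nonneg fun i _ => (hV _).1 _)
  refine squeeze_zero (fun n => ?_) (fun n => ?_)
    (tendsto_sum_prod_ite_nonneg (isPMF_joint hQ hV) _ hneg)
  · refine Finset.sum_nonneg fun w _ => Finset.sum_nonneg fun a _ => ?_
    split_ifs
    exacts [h0 n w a, le_rfl]
  · rw [← Fintype.sum_prod_type', ← (Equiv.arrowProdEquivProdArrow (Fin n) (fun _ => W)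
      (fun _ => A)).sum_comp]
    refine Finset.sum_le_sum fun x _ => ?_
    simp only [Equiv.arrowProdEquivProdArrow_apply, sum_prod_mul_prod_eq]
    rw [Finset.prod_mul_distrib]
    split_ifs with h1 h2 h2
    · exact le_rfl
    · refine le_of_eq ?_
      by_contra hne
      rw [← Finset.prod_mul_distrib, Finset.prod_eq_zero_iff, not_exists] at hne
      have hp := fun i => pos_of_prod_ne_zero hQ hV
        (fun h => hne i ⟨Finset.mem_univ i, h⟩ : Q (x i).1 * V (x i).1 (x i).2 ≠ 0)
      apply h2
      have hlog := Real.log_lt_log (mul_pos (by positivity)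
        (Finset.prod_pos fun i _ => (hp i).2)) h1
      rw [Real.log_mul (by positivity) (Finset.prod_pos fun i _ => (hp i).2).ne',
        Real.log_prod fun i _ => (hp i).2.ne', Real.log_prod fun i _ => (hp i).1.ne',
        log_two_rpow_nat_mul] at hlog
      simp only [fun i => Real.log_div (hp i).1.ne' (hp i).2.ne', Finset.sum_sub_distrib]
      linarith
    · exact h0 n _ _
    · exact le_rfl

theorem tendsto_infoDensity_lower {Q : W → ℝ} {V : W → A → ℝ} (hQ : IsPMF Q)
    (hV : ∀ w, IsPMF (V w)) {t : ℝ} (ht : t < channelInfo Q V) :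
    Tendsto (fun n : ℕ => ∑ w : Fin n → W, ∑ a : Fin n → A,
      if ∏ i, V (w i) (a i)
          < (2 : ℝ) ^ ((n : ℝ) * t) * ∑ w' : Fin n → W, (∏ i, Q (w' i)) * ∏ i, V (w' i) (a i)
        then (∏ i, Q (w i)) * ∏ i, V (w i) (a i) else 0) atTop (𝓝 0) := by
  have hl := sum_joint_mul_log hQ hV t
  have hneg : -((channelInfo Q V - t) * Real.log 2) < 0 :=
    neg_neg_of_pos (mul_pos (by linarith) (Real.log_pos one_lt_two))
  rw [← hl, ← Finset.sum_neg_distrib] at hneg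
  simp only [← mul_neg] at hneg
  have h0 : ∀ (n : ℕ) (w : Fin n → W) (a : Fin n → A),
      0 ≤ (∏ i, Q (w i)) * ∏ i, V (w i) (a i) := fun n w a =>
    mul_nonneg (Finset.prod_nonneg fun i _ => hQ.1 _) (Finset.prod_nonneg fun i _ => (hV _).1 _)
  refine squeeze_zero (fun n => ?_) (fun n => ?_)
    (tendsto_sum_prod_ite_nonneg (isPMF_joint hQ hV) _ hneg)
  · refine Finset.sum_nonneg fun w _ => Finset.sum_nonneg fun a _ => ?_
    split_ifs
    exacts [h0 n w a, le_rfl]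
  · rw [← Fintype.sum_prod_type', ← (Equiv.arrowProdEquivProdArrow (Fin n) (fun _ => W)
      (fun _ => A)).sum_comp]
    refine Finset.sum_le_sum fun x _ => ?_
    simp only [Equiv.arrowProdEquivProdArrow_apply, sum_prod_mul_prod_eq]
    rw [Finset.prod_mul_distrib]
    split_ifs with h1 h2 h2
    · exact le_rfl
    · refine le_of_eq ?_
      by_contra hne
      rw [← Finset.prod_mul_distrib, Finset.prod_eq_zero_iff, not_exists] at hne
      have hp := fun i => pos_of_prod_ne_zero hQ hV
        (fun h => hne i ⟨Finset.mem_univ i, h⟩ : Q (x i).1 * V (x i).1 (x i).2 ≠ 0)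
      apply h2
      have hlog := Real.log_lt_log (Finset.prod_pos fun i _ => (hp i).1) h1
      rw [Real.log_mul (by positivity) (Finset.prod_pos fun i _ => (hp i).2).ne',
        Real.log_prod fun i _ => (hp i).2.ne', Real.log_prod fun i _ => (hp i).1.ne',
        log_two_rpow_nat_mul] at hlog
      simp only [fun i => Real.log_div (hp i).1.ne' (hp i).2.ne', Finset.sum_sub_distrib,
        Finset.sum_neg_distrib]
      linarith
    · exact h0 n _ _
    · exact le_rfl

end Tails

section Marginals

variable {α β : Type*} [Fintype α] [Fintype β]

/-- Indicator of a proposition. -/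
def ind (p : Prop) : ℝ := if p then 1 else 0

theorem ind_and (p q : Prop) : ind (p ∧ q) = ind p * ind q := by
  by_cases hp : p <;> by_cases hq : q <;> simp [ind, hp, hq]

theorem sum_ind_mul (a : α) (f : α → ℝ) : ∑ x, ind (x = a) * f x = f a := by
  simp [ind]

theorem push_eq_sum_ind {γ : Type*} (P : α → ℝ) (f : α → γ) (c : γ) :
    push P f c = ∑ x, ind (f x = c) * P x := by
  simp [push, ind]

theorem push_fst_eq (P : α × β → ℝ) (a : α) : push P Prod.fst a = ∑ b, P (a, b) := by
  rw [push, Fintype.sum_prod_type, Finset.sum_eq_single a]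
  · simp
  · intro a' _ h
    simp [h]
  · simp

theorem push_snd_eq (P : α × β → ℝ) (b : β) : push P Prod.snd b = ∑ a, P (a, b) := by
  simp [push, Fintype.sum_prod_type]

theorem I2_eq_sum (P : α × β → ℝ) (hP : ∀ x, 0 ≤ P x) :
    I2 P = ∑ a, ∑ b, P (a, b) *
      Real.logb 2 (P (a, b) / ((∑ b', P (a, b')) * ∑ a', P (a', b))) := by
  have hterm : ∀ a b, P (a, b) *
      Real.logb 2 (P (a, b) / ((∑ b', P (a, b')) * ∑ a', P (a', b)))
      = P (a, b) * Real.logb 2 (P (a, b)) - P (a, b) * Real.logb 2 (∑ b', P (a, b'))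
        - P (a, b) * Real.logb 2 (∑ a', P (a', b)) := by
    intro a b
    by_cases h : P (a, b) = 0
    · simp [h]
    · have hpos : 0 < P (a, b) := lt_of_le_of_ne (hP _) (Ne.symm h)
      have h1 : 0 < ∑ b', P (a, b') := hpos.trans_le
        (Finset.single_le_sum (f := fun b' => P (a, b')) (fun b' _ => hP _) (Finset.mem_univ b))
      have h2 : 0 < ∑ a', P (a', b) := hpos.trans_le
        (Finset.single_le_sum (f := fun a' => P (a', b)) (fun a' _ => hP _) (Finset.mem_univ a))
      rw [Real.logb_div h (mul_pos h1 h2).ne', Real.logb_mul h1.ne' h2.ne']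
      ring
  simp only [hterm, Finset.sum_sub_distrib]
  have e : ∑ a, ∑ b, P (a, b) * Real.logb 2 (∑ a', P (a', b))
      = ∑ b, (∑ a, P (a, b)) * Real.logb 2 (∑ a', P (a', b)) := by
    rw [Finset.sum_comm]
    simp only [← Finset.sum_mul]
  rw [e, I2, Hent, Hent, Hent, Fintype.sum_prod_type]
  simp only [push_fst_eq, push_snd_eq, Finset.sum_neg_distrib, ← Finset.sum_mul]
  ring

theorem I2_eq_channelInfo {Q : α → ℝ} {V : α → β → ℝ} (hQ : IsPMF Q) (hV : ∀ a, IsPMF (V a))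
    {P : α × β → ℝ} (hP : ∀ a b, P (a, b) = Q a * V a b) : I2 P = channelInfo Q V := by
  have h0 : ∀ x, 0 ≤ P x := fun x => by
    rw [← Prod.eta x, hP]
    exact mul_nonneg (hQ.1 _) ((hV _).1 _)
  rw [I2_eq_sum P h0, channelInfo]
  refine Finset.sum_congr rfl fun a _ => Finset.sum_congr rfl fun b _ => ?_
  simp only [hP]
  rw [← Finset.mul_sum, (hV a).2, mul_one]
  by_cases h : Q a = 0
  · simp [h]
  · rw [mul_div_mul_left _ _ h]

theorem I2_swap_eq_channelInfo {Q : α → ℝ} {V : α → β → ℝ} (hQ : IsPMF Q)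
    (hV : ∀ a, IsPMF (V a)) {P : β × α → ℝ} (hP : ∀ a b, P (b, a) = Q a * V a b) :
    I2 P = channelInfo Q V := by
  have h0 : ∀ x, 0 ≤ P x := fun x => by
    rw [← Prod.eta x, hP]
    exact mul_nonneg (hQ.1 _) ((hV _).1 _)
  rw [I2_eq_sum P h0, channelInfo, Finset.sum_comm]
  refine Finset.sum_congr rfl fun a _ => Finset.sum_congr rfl fun b _ => ?_
  simp only [hP]
  rw [← Finset.mul_sum, (hV a).2, mul_one, mul_comm (∑ a', Q a' * V a' b)]
  by_cases h : Q a = 0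
  · simp [h]
  · rw [mul_div_mul_left _ _ h]

theorem isPMF_prod {ι : Type*} [Fintype ι] [DecidableEq ι] {P : ι → α → ℝ}
    (hP : ∀ i, IsPMF (P i)) : IsPMF fun x : ι → α => ∏ i, P i (x i) := by
  refine ⟨fun x => Finset.prod_nonneg fun i _ => (hP i).1 _, ?_⟩
  rw [← Fintype.piFinset_univ, ← Finset.prod_univ_sum]
  simp [(hP _).2]

/-- A law with the Markov chains `Z − X − W` and `X − (Z, W) − Y` factors through kernels. -/
theorem exists_kernels_of_markov {X Y Z W : Type} [Fintype X] [Fintype Y] [Fintype Z] [Fintype W]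
    {q : W × (X × Y × Z) → ℝ} (hq : IsPMF q)
    (hMk1 : Markov (push q (fun u => (u.2.2.2, u.2.1, u.1))))
    (hMk2 : Markov (push q (fun u => (u.2.1, (u.2.2.2, u.1), u.2.2.1)))) :
    ∃ (Q : W → ℝ) (a : W → X → ℝ) (b : X → Z → ℝ) (d : W → Z → Y → ℝ),
      IsPMF Q ∧ (∀ w, IsPMF (a w)) ∧ (∀ x, IsPMF (b x)) ∧ (∀ w z, IsPMF (d w z)) ∧
      ∀ w x y z, q (w, x, y, z) = Q w * (a w x * b x z * d w z y) := by
  have hne : Nonempty (W × X × Y × Z) := by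
    by_contra h
    rw [not_nonempty_iff] at h
    have := hq.2
    simp at this
  obtain ⟨w₀, x₀, y₀, z₀⟩ := hne
  have : Nonempty X := ⟨x₀⟩
  have : Nonempty Y := ⟨y₀⟩
  have : Nonempty Z := ⟨z₀⟩
  have h0 := hq.1
  set qWX : W → X → ℝ := fun w x => ∑ y, ∑ z, q (w, x, y, z) with hqWX
  set qXZ : X → Z → ℝ := fun x z => ∑ w, ∑ y, q (w, x, y, z) with hqXZ
  set qWZY : W → Z → Y → ℝ := fun w z y => ∑ x, q (w, x, y, z) with hqWZY
  set qWXZ : W → X → Z → ℝ := fun w x z => ∑ y, q (w, x, y, z) with hqWXZ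
  have hWX0 : ∀ w x, 0 ≤ qWX w x := fun w x =>
    Finset.sum_nonneg fun _ _ => Finset.sum_nonneg fun _ _ => h0 _
  have hXZ0 : ∀ x z, 0 ≤ qXZ x z := fun w x =>
    Finset.sum_nonneg fun _ _ => Finset.sum_nonneg fun _ _ => h0 _
  have hWZY0 : ∀ w z y, 0 ≤ qWZY w z y := fun w z y => Finset.sum_nonneg fun _ _ => h0 _
  have hWXZ0 : ∀ w x z, 0 ≤ qWXZ w x z := fun w x z => Finset.sum_nonneg fun _ _ => h0 _
  choose a ha haq using fun w => exists_isPMF_sum_mul_eq (qWX w) (hWX0 w)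
  choose b hb hbq using fun x => exists_isPMF_sum_mul_eq (qXZ x) (hXZ0 x)
  choose d hd hdq using fun w z => exists_isPMF_sum_mul_eq (qWZY w z) (hWZY0 w z)
  have hmk1 : ∀ w x z, qWXZ w x z * (∑ z', qXZ x z') = qXZ x z * qWX w x := by
    intro w x z
    have h := hMk1 z x w
    simp only [push_eq_sum_ind, Fintype.sum_prod_type, Prod.mk.injEq, ind_and, mul_assoc,
      ← Finset.mul_sum, sum_ind_mul] at h
    have e : qWX w x = ∑ z', ∑ y, q (w, x, y, z') := Finset.sum_comm
    rw [e]
    exact h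
  have hmk2 : ∀ w x y z, q (w, x, y, z) * (∑ y', qWZY w z y') = qWXZ w x z * qWZY w z y := by
    intro w x y z
    have h := hMk2 x (z, w) y
    simp only [push_eq_sum_ind, Fintype.sum_prod_type, Prod.mk.injEq, ind_and, mul_assoc,
      ← Finset.mul_sum, sum_ind_mul] at h
    have e : ∑ y', qWZY w z y' = ∑ x', ∑ y', q (w, x', y', z) := Finset.sum_comm
    rw [e]
    exact h
  refine ⟨fun w => ∑ x, qWX w x, a, b, d, ⟨fun w => Finset.sum_nonneg fun x _ => hWX0 w x, ?_⟩,
    ha, hb, hd, fun w x y z => ?_⟩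
  · rw [← hq.2]
    simp only [Fintype.sum_prod_type, hqWX]
  · have e1 : qWXZ w x z = qWX w x * b x z := by
      by_cases hx : ∑ z', qXZ x z' = 0
      · have hz : ∀ z', qXZ x z' = 0 := fun z' =>
          (Finset.sum_eq_zero_iff_of_nonneg fun k _ => hXZ0 x k).mp hx z' (Finset.mem_univ _)
        have hall : ∀ w y z, q (w, x, y, z) = 0 := fun w y z =>
          (Finset.sum_eq_zero_iff_of_nonneg fun k _ => h0 _).mp
            ((Finset.sum_eq_zero_iff_of_nonneg fun k _ =>
              Finset.sum_nonneg fun _ _ => h0 _).mp (hz z) w (Finset.mem_univ _)) y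
              (Finset.mem_univ _)
        simp [hqWXZ, hqWX, hall]
      · have := hmk1 w x z
        rw [← hbq x z] at this
        apply mul_right_cancel₀ hx
        rw [this]
        ring
    have e2 : q (w, x, y, z) = qWXZ w x z * d w z y := by
      by_cases hx : ∑ y', qWZY w z y' = 0
      · have hz : ∀ y', qWZY w z y' = 0 := fun y' =>
          (Finset.sum_eq_zero_iff_of_nonneg fun k _ => hWZY0 w z k).mp hx y' (Finset.mem_univ _)
        have hall : ∀ x y, q (w, x, y, z) = 0 := fun x y =>
          (Finset.sum_eq_zero_iff_of_nonneg fun k _ => h0 _).mp (hz y) x (Finset.mem_univ _)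
        simp [hqWXZ, hall]
      · have := hmk2 w x y z
        rw [← hdq w z y] at this
        apply mul_right_cancel₀ hx
        rw [this]
        ring
    rw [e2, e1, ← haq w x]
    ring

end Marginals

section Achievability

open Filter Topology

theorem sum_pi_prod_mul_prod {α : Type*} [Fintype α] {n : ℕ} (f g : Fin n → α → ℝ) :
    ∑ x : Fin n → α, (∏ i, f i (x i)) * ∏ i, g i (x i) = ∏ i, ∑ x, f i x * g i x := by
  rw [Finset.prod_univ_sum, Fintype.piFinset_univ]
  simp only [Finset.prod_mul_distrib]

theorem inv_mul_logb_natCeil_le {n : ℕ} {R ε : ℝ} (hR : 0 ≤ R) (hε : 0 < ε)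
    (hn : 2 / ε ≤ (n : ℝ)) :
    1 / (n : ℝ) * Real.logb 2 (⌈(2 : ℝ) ^ ((n : ℝ) * (R + ε / 2))⌉₊ : ℝ) ≤ R + ε := by
  have hn0 : (0 : ℝ) < n := (by positivity : 0 < 2 / ε).trans_le hn
  set r : ℝ := (n : ℝ) * (R + ε / 2) with hr
  have hr0 : 0 ≤ r := by positivity
  have h1 : (1 : ℝ) ≤ 2 ^ r := Real.one_le_rpow one_le_two hr0
  have hle : (⌈(2 : ℝ) ^ r⌉₊ : ℝ) ≤ 2 ^ (1 + r) := by
    rw [Real.rpow_add two_pos, Real.rpow_one]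
    linarith [Nat.ceil_lt_add_one (zero_le_one.trans h1)]
  have hpos : (0 : ℝ) < ⌈(2 : ℝ) ^ r⌉₊ := by
    exact_mod_cast Nat.ceil_pos.mpr (by linarith)
  have hlog : Real.logb 2 (⌈(2 : ℝ) ^ r⌉₊ : ℝ) ≤ 1 + r := by
    rw [← Real.logb_rpow (b := 2) (x := 1 + r) two_pos (by norm_num)]
    exact Real.logb_le_logb_of_le one_lt_two hpos hle
  rw [one_div, inv_mul_le_iff₀ hn0]
  rw [div_le_iff₀ hε] at hn
  rw [hr] at hlog
  linarith

theorem sqrt_rpow_div_le {n : ℕ} {I δ N : ℝ} (hN : (2 : ℝ) ^ ((n : ℝ) * (I + 2 * δ)) ≤ N) :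
    √((2 : ℝ) ^ ((n : ℝ) * (I + δ)) / N) ≤ √(((2 : ℝ) ^ (-δ)) ^ n) := by
  apply Real.sqrt_le_sqrt
  have h0 : (0 : ℝ) < 2 ^ ((n : ℝ) * (I + 2 * δ)) := by positivity
  calc (2 : ℝ) ^ ((n : ℝ) * (I + δ)) / N
      ≤ (2 : ℝ) ^ ((n : ℝ) * (I + δ)) / 2 ^ ((n : ℝ) * (I + 2 * δ)) := by gcongr
    _ = (2 : ℝ) ^ (-δ * n) := by
        rw [← Real.rpow_sub two_pos]
        congr 1
        ring
    _ = _ := by rw [Real.rpow_mul two_pos.le, Real.rpow_natCast]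

variable {X Y Z W : Type} [Fintype X] [Fintype Y] [Fintype Z] [Fintype W]

/-- Sequences of triples as triples of sequences. -/
def arrowTripleEquiv (X Y Z : Type) (n : ℕ) :
    (Fin n → X × Y × Z) ≃ (Fin n → X) × (Fin n → Y) × (Fin n → Z) where
  toFun v := (fun i => (v i).1, fun i => (v i).2.1, fun i => (v i).2.2)
  invFun v i := (v.1 i, v.2.1 i, v.2.2 i)
  left_inv _ := rfl
  right_inv _ := rfl

theorem rsAchievable_of_kernels {p : X × Y × Z → ℝ} {Q : W → ℝ} {a : W → X → ℝ}
    {b : X → Z → ℝ} {d : W → Z → Y → ℝ} (hQ : IsPMF Q) (ha : ∀ w, IsPMF (a w))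
    (hb : ∀ x, IsPMF (b x)) (hd : ∀ w z, IsPMF (d w z))
    (hp : ∀ x y z, p (x, y, z) = ∑ w, Q w * (a w x * b x z * d w z y))
    {R C Rt : ℝ} (hR : 0 ≤ R) (h1 : channelInfo Q a ≤ Rt)
    (h2 : Rt - R ≤ channelInfo Q fun w z => ∑ x, a w x * b x z)
    (h3 : channelInfo Q (fun w (v : X × Y × Z) => a w v.1 * b v.1 v.2.2 * d w v.2.2 v.2.1)
      ≤ Rt + C) :
    RsAchievable p R C := by
  intro ε hε
  set u : W → Z → ℝ := fun w z => ∑ x, a w x * b x z with hu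
  set V : W → X × Y × Z → ℝ := fun w v => a w v.1 * b v.1 v.2.2 * d w v.2.2 v.2.1 with hV
  have hu' : ∀ w, IsPMF (u w) := fun w => (ha w).mixture hb
  have hV' : ∀ w, IsPMF (V w) := fun w => isPMF_tripleKernel (ha w) hb (hd w)
  set δ : ℝ := ε / 8 with hδ
  have hδ0 : 0 < δ := by positivity
  set I₁ := channelInfo Q a with hI₁
  set I₂ := channelInfo Q V with hI₂
  set I₃ := channelInfo Q u with hI₃
  have ht1 := tendsto_infoDensity_upper hQ ha (lt_add_of_pos_right I₁ hδ0)
  have ht2 := tendsto_infoDensity_upper hQ hV' (lt_add_of_pos_right I₂ hδ0)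
  have ht3 := tendsto_infoDensity_lower hQ hu' (sub_lt_self I₃ hδ0)
  have hr : Tendsto (fun n : ℕ => ((2 : ℝ) ^ (-δ)) ^ n) atTop (𝓝 0) :=
    tendsto_pow_atTop_nhds_zero_of_lt_one (by positivity)
      (Real.rpow_lt_one_of_one_lt_of_neg one_lt_two (by linarith))
  have hs : Tendsto (fun n : ℕ => √(((2 : ℝ) ^ (-δ)) ^ n)) atTop (𝓝 0) := by
    simpa using hr.sqrt
  have htot := (((ht2.const_mul 2).add hs).add ((ht1.const_mul 2).add hs)).add
    ((ht3.add hr).const_mul 2)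
  simp only [mul_zero, add_zero] at htot
  have hev := (htot.eventually (Iio_mem_nhds (by positivity : (0 : ℝ) < 2 * ε))).and
    (eventually_ge_atTop ⌈2 / ε⌉₊)
  obtain ⟨N, hN⟩ := eventually_atTop.mp hev
  refine ⟨N, fun n hn => ?_⟩
  obtain ⟨herr, hnε⟩ := hN n hn
  have hnε' : 2 / ε ≤ (n : ℝ) := Nat.ceil_le.mp hnε
  set Θ : ℕ := ⌈(2 : ℝ) ^ ((n : ℝ) * (R + ε / 2))⌉₊ with hΘ
  set B : ℕ := ⌊(2 : ℝ) ^ ((n : ℝ) * (I₃ - 2 * δ))⌋₊ + 1 with hB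
  have hΘle : (2 : ℝ) ^ ((n : ℝ) * (R + ε / 2)) ≤ Θ := Nat.le_ceil _
  have hBle : (2 : ℝ) ^ ((n : ℝ) * (I₃ - 2 * δ)) ≤ B := by
    rw [hB]
    push_cast
    exact (Nat.lt_floor_add_one _).le
  have hKle : (2 : ℝ) ^ ((n : ℝ) * C) ≤ NC n C := Nat.le_ceil _
  have hΘB : (2 : ℝ) ^ ((n : ℝ) * (R + ε / 2 + (I₃ - 2 * δ))) ≤ (Θ : ℝ) * B := by
    rw [mul_add, Real.rpow_add two_pos]
    gcongr
  have hcard1 : (2 : ℝ) ^ ((n : ℝ) * (I₁ + 2 * δ)) ≤ (Θ : ℝ) * B := by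
    refine le_trans (Real.rpow_le_rpow_of_exponent_le one_le_two ?_) hΘB
    exact mul_le_mul_of_nonneg_left (by linarith) (Nat.cast_nonneg n)
  have hcard2 : (2 : ℝ) ^ ((n : ℝ) * (I₂ + 2 * δ)) ≤ (NC n C : ℝ) * ((Θ : ℝ) * B) := by
    refine le_trans (Real.rpow_le_rpow_of_exponent_le one_le_two
      (?_ : _ ≤ (n : ℝ) * C + (n : ℝ) * (R + ε / 2 + (I₃ - 2 * δ)))) ?_
    · rw [← mul_add]
      exact mul_le_mul_of_nonneg_left (by linarith) (Nat.cast_nonneg n)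
    · rw [Real.rpow_add two_pos]
      gcongr
  have : Nonempty (Fin (NC n C)) := ⟨⟨0, Nat.ceil_pos.mpr (by positivity)⟩⟩
  have : Nonempty (Fin Θ) := ⟨⟨0, Nat.ceil_pos.mpr (by positivity)⟩⟩
  have : Nonempty (Fin B) := ⟨⟨0, Nat.succ_pos _⟩⟩
  obtain ⟨enc, dec, henc, hdec, hle⟩ := exists_codes (κ := Fin (NC n C)) (θ := Fin Θ)
    (β := Fin B) (W := Fin n → W) (X := Fin n → X) (Y := Fin n → Y) (Z := Fin n → Z)
    (Q := fun w => ∏ i, Q (w i)) (a := fun w x => ∏ i, a (w i) (x i))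
    (b := fun x z => ∏ i, b (x i) (z i)) (d := fun w z y => ∏ i, d (w i) (z i) (y i))
    (isPMF_prod fun _ => hQ) (fun w => isPMF_prod fun i => ha (w i))
    (fun x => isPMF_prod fun i => hb (x i)) (fun w z => isPMF_prod fun i => hd (w i) (z i))
    (T₁ := (2 : ℝ) ^ ((n : ℝ) * (I₁ + δ))) (T₂ := (2 : ℝ) ^ ((n : ℝ) * (I₂ + δ)))
    (τ := (2 : ℝ) ^ ((n : ℝ) * (I₃ - δ))) (by positivity) (by positivity) (by positivity)
  refine ⟨Θ, inv_mul_logb_natCeil_le hR hε hnε', enc, dec, henc, hdec, ?_⟩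
  have hprodV : ∀ (w : Fin n → W) (v : (Fin n → X) × (Fin n → Y) × (Fin n → Z)),
      (∏ i, a (w i) (v.1 i)) * (∏ i, b (v.1 i) (v.2.2 i)) * ∏ i, d (w i) (v.2.2 i) (v.2.1 i)
        = ∏ i, V (w i) (v.1 i, v.2.1 i, v.2.2 i) := by
    intro w v
    simp only [hV, Finset.prod_mul_distrib]
  have hprodu : ∀ (w : Fin n → W) (z : Fin n → Z),
      ∑ x : Fin n → X, (∏ i, a (w i) (x i)) * (∏ i, b (x i) (z i)) = ∏ i, u (w i) (z i) :=
    fun w z => sum_pi_prod_mul_prod (fun i => a (w i)) (fun i x => b x (z i))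
  have htarget : ∀ v : (Fin n → X) × (Fin n → Y) × (Fin n → Z),
      ∑ w : Fin n → W, (∏ i, Q (w i)) * ∏ i, V (w i) (v.1 i, v.2.1 i, v.2.2 i)
        = ∏ i, p (v.1 i, v.2.1 i, v.2.2 i) := by
    intro v
    rw [sum_prod_mul_prod_eq n Q V (fun i => (v.1 i, v.2.1 i, v.2.2 i))]
    exact Finset.prod_congr rfl fun i _ => (hp _ _ _).symm
  have hpXZ : ∀ x z, push p (fun v => (v.1, v.2.2)) (x, z) = (∑ w, Q w * a w x) * b x z := by
    intro x z
    simp only [push_eq_sum_ind, Fintype.sum_prod_type, Prod.mk.injEq, ind_and, mul_assoc,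
      ← Finset.mul_sum, sum_ind_mul, hp]
    rw [Finset.sum_comm]
    simp only [← Finset.mul_sum, (hd _ _).2, mul_one, Finset.sum_mul, mul_assoc]
  have hsource : ∀ (x : Fin n → X) (z : Fin n → Z),
      (∑ w : Fin n → W, (∏ i, Q (w i)) * ∏ i, a (w i) (x i)) * ∏ i, b (x i) (z i)
        = ∏ i, push p (fun v => (v.1, v.2.2)) (x i, z i) := by
    intro x z
    rw [sum_prod_mul_prod_eq n Q a x, ← Finset.prod_mul_distrib]
    exact Finset.prod_congr rfl fun i _ => (hpXZ _ _).symm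
  have hreindex : ∀ F : (Fin n → X) × (Fin n → Y) × (Fin n → Z) → ℝ,
      ∑ v, F v = ∑ v : Fin n → X × Y × Z,
        F (fun i => (v i).1, fun i => (v i).2.1, fun i => (v i).2.2) := fun F =>
    ((arrowTripleEquiv X Y Z n).sum_comp F).symm
  simp only [hprodV, hprodu, htarget, hsource, Fintype.card_prod, Fintype.card_fin,
    Nat.cast_mul] at hle
  have hdecode : ((B - 1 : ℕ) : ℝ) / 2 ^ ((n : ℝ) * (I₃ - δ)) ≤ ((2 : ℝ) ^ (-δ)) ^ n := by
    rw [hB, Nat.add_sub_cancel, div_le_iff₀ (by positivity), ← Real.rpow_natCast,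
      ← Real.rpow_mul two_pos.le, ← Real.rpow_add two_pos]
    refine (Nat.floor_le (by positivity)).trans_eq ?_
    congr 1
    ring
  have hcover := sqrt_rpow_div_le hcard2
  have hencode := sqrt_rpow_div_le hcard1
  have htail : ∑ w : Fin n → W, ∑ v : (Fin n → X) × (Fin n → Y) × (Fin n → Z),
      (if (2 : ℝ) ^ ((n : ℝ) * (I₂ + δ)) * ∏ i, p (v.1 i, v.2.1 i, v.2.2 i)
          < ∏ i, V (w i) (v.1 i, v.2.1 i, v.2.2 i)
        then (∏ i, Q (w i)) * ∏ i, V (w i) (v.1 i, v.2.1 i, v.2.2 i) else 0)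
      = ∑ w : Fin n → W, ∑ v : Fin n → X × Y × Z,
        if (2 : ℝ) ^ ((n : ℝ) * (I₂ + δ)) * ∑ w' : Fin n → W, (∏ i, Q (w' i)) * ∏ i, V (w' i) (v i)
            < ∏ i, V (w i) (v i)
          then (∏ i, Q (w i)) * ∏ i, V (w i) (v i) else 0 := by
    refine Finset.sum_congr rfl fun w _ => ?_
    rw [hreindex]
    refine Finset.sum_congr rfl fun v _ => ?_
    have hv : ∑ w' : Fin n → W, (∏ i, Q (w' i)) * ∏ i, V (w' i) (v i) = ∏ i, p (v i) :=
      htarget (fun i => (v i).1, fun i => (v i).2.1, fun i => (v i).2.2)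
    simp only [hv]
  rw [htail] at hle
  rw [tvDist]
  linarith

end Achievability

/-- **Achievability part of Theorem 1.** If `q` is a joint PMF on `𝒲 × (𝒳 × 𝒴 × 𝒵)` whose
`𝒳 × 𝒴 × 𝒵`-marginal is `p`, with Markov chains `Z − X − W` and `X − (Z,W) − Y`,
and nonnegative reals `R, C` and a real `R̃` satisfy `R̃ ≥ I(X;W)`, `R̃ − R ≤ I(W;Z)`
and `R̃ + C ≥ I(X,Y,Z;W)`, then `(R,C) ∈ ℛ_s(p)`. -/
theorem statement1 {X Y Z W : Type} [Fintype X] [Fintype Y] [Fintype Z] [Fintype W]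
    (p : X × Y × Z → ℝ) (hp : IsPMF p)
    (q : W × (X × Y × Z) → ℝ) (hq : IsPMF q)
    (hmarg : ∀ v : X × Y × Z, push q Prod.snd v = p v)
    (hMk1 : Markov (push q (fun u => (u.2.2.2, u.2.1, u.1))))
    (hMk2 : Markov (push q (fun u => (u.2.1, (u.2.2.2, u.1), u.2.2.1))))
    (R C Rt : ℝ) (hR : 0 ≤ R) (hC : 0 ≤ C)
    (h1 : I2 (push q (fun u => (u.2.1, u.1))) ≤ Rt)
    (h2 : Rt - R ≤ I2 (push q (fun u => (u.1, u.2.2.2))))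
    (h3 : I2 (push q (fun u => (u.2, u.1))) ≤ Rt + C) :
    RsAchievable p R C := by
  obtain ⟨Q, a, b, d, hQ, ha, hb, hd, hker⟩ := exists_kernels_of_markov hq hMk1 hMk2
  have hXW : I2 (push q (fun u => (u.2.1, u.1))) = channelInfo Q a := by
    refine I2_swap_eq_channelInfo hQ ha fun w x => ?_
    simp only [push_eq_sum_ind, Fintype.sum_prod_type, Prod.mk.injEq, ind_and, mul_assoc,
      ← Finset.mul_sum, sum_ind_mul]
    simp only [hker]
    rw [Finset.sum_comm]
    simp only [← Finset.mul_sum, (hd _ _).2, (hb _).2, mul_one]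
  have hWZ : I2 (push q (fun u => (u.1, u.2.2.2)))
      = channelInfo Q fun w z => ∑ x, a w x * b x z := by
    refine I2_eq_channelInfo hQ (fun w => (ha w).mixture hb) fun w z => ?_
    simp only [push_eq_sum_ind, Fintype.sum_prod_type, Prod.mk.injEq, ind_and, mul_assoc,
      ← Finset.mul_sum, sum_ind_mul, hker]
    simp only [(hd _ _).2, mul_one]
  have hVW : I2 (push q (fun u => (u.2, u.1))) = channelInfo Q
      fun w (v : X × Y × Z) => a w v.1 * b v.1 v.2.2 * d w v.2.2 v.2.1 := by
    refine I2_swap_eq_channelInfo hQ (fun w => isPMF_tripleKernel (ha w) hb (hd w)) ?_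
    rintro w ⟨x, y, z⟩
    simp only [push_eq_sum_ind, Fintype.sum_prod_type, Prod.mk.injEq, ind_and, mul_assoc,
      sum_ind_mul, hker]
  refine rsAchievable_of_kernels hQ ha hb hd (fun x y z => ?_) hR (hXW ▸ h1) (hWZ ▸ h2) (hVW ▸ h3)
  rw [← hmarg, push_snd_eq]
  simp only [hker]
end
end

section
/- Let 𝒳 and 𝒲 be finite sets and p_{XW} a PMF on 𝒳×𝒲 with marginals p_X, p_W. Fix C ≥ 0 and R̃ > 0, let ε := 1 − p^n_W(T_δ(W)), and let the codebook consist of codewords w^n(l,μ), l ∈ [⌈2^{nR̃}⌉], μ ∈ [⌈2^{nC}⌉], drawn i.i.d. from the pruned distribution p̃_{W^n}. For δ, η ∈ (0,1), define for each μ and each x^n ∈ T_δ(X): E^{(μ)}_{L|X^n}(l|x^n) = (1−ε)·p^n_{X|W}(x^n|w^n(l,μ)) / ((1+η)·⌈2^{nR̃}⌉·p^n_X(x^n)) if w^n(l,μ) ∈ T_δ(W|x^n), and E^{(μ)}_{L|X^n}(l|x^n) = 0 otherwise. Then there exists δ₁ > 0, depending only on δ and p_{XW} and satisfying δ₁ →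 0 as δ → 0, such that if R̃ > I(X;W) + 4δ₁ then the probability of the event { for every μ ∈ [⌈2^{nC}⌉] and every x^n ∈ T_δ(X): Σ_{l} E^{(μ)}_{L|X^n}(l|x^n) ≤ 1 } tends to 1 as n → ∞. -/
open scoped BigOperators Classical

noncomputable section

/-- Empirical distribution of the sequence `x : Fin n → α`, evaluated at `a`. -/
def empir {α : Type*} [Fintype α] {n : ℕ} (x : Fin n → α) (a : α) : ℝ :=
  ((Finset.univ.filter fun i => x i = a).card : ℝ) / (n : ℝ)

/-- The `δ`-typical set of a PMF `q` on `α`, inside `α^n`: sequences whose empirical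
distribution `ν` satisfies `|ν a − q a| ≤ δ q a` for every `a`. -/
def Typ {α : Type*} [Fintype α] (q : α → ℝ) (δ : ℝ) (n : ℕ) : Finset (Fin n → α) :=
  Finset.univ.filter fun x => ∀ a, |empir x a - q a| ≤ δ * q a

/-- `p^n_W(T_δ(W))`: probability of the `δ`-typical set under the product distribution. -/
def prunedMass {W : Type*} [Fintype W] (pW : W → ℝ) (δ : ℝ) (n : ℕ) : ℝ :=
  ∑ wn ∈ Typ pW δ n, ∏ i, pW (wn i)

/-- The pruned distribution `p̃_{W^n}`: `p^n_W` conditioned on the `δ`-typical set. -/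
def pruned {W : Type*} [Fintype W] (pW : W → ℝ) (δ : ℝ) (n : ℕ) (wn : Fin n → W) : ℝ :=
  if wn ∈ Typ pW δ n then (∏ i, pW (wn i)) / prunedMass pW δ n else 0

/-- The encoder weight `E^{(μ)}_{L|X^n}(l|x^n)` attached to the codeword `wn`:
`(1−ε) p^n_{X|W}(x^n|w^n) / ((1+η) L p^n_X(x^n))` if `w^n ∈ T_δ(W|x^n)`
(i.e. `(x^n, w^n)` is jointly `δ`-typical), and `0` otherwise.  Here `epsv` plays the
role of `ε`, `L` of `⌈2^{nR̃}⌉`, and `p` is the joint PMF of `(X, W)`. -/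
def Eenc {X W : Type*} [Fintype X] [Fintype W] (p : X × W → ℝ)
    (epsv η δ : ℝ) (n L : ℕ) (wn : Fin n → W) (xn : Fin n → X) : ℝ :=
  if (fun i => (xn i, wn i)) ∈ Typ p δ n then
    (1 - epsv) * (∏ i, p (xn i, wn i) / push p Prod.snd (wn i)) /
      ((1 + η) * (L : ℝ) * ∏ i, push p Prod.fst (xn i))
  else 0

/-- Chernoff-type upper tail bound for a sum of i.i.d. nonnegative bounded variables. -/
lemma sum_filter_one_lt_prod_le {Ω J : Type*} [Fintype Ω] [Fintype J] [DecidableEq J]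
    {q f : Ω → ℝ} (hq : IsPMF q) (S : Finset J) {M η m : ℝ} (hM : 0 < M) (hη : 0 < η)
    (hf : ∀ w, 0 ≤ f w) (hfM : ∀ w, f w ≤ M) (hm : ∑ w, q w * f w ≤ m) :
    ∑ B ∈ Finset.univ.filter (fun B : J → Ω => 1 < ∑ j ∈ S, f (B j)), ∏ j, q (B j)
      ≤ (1 + η) ^ (-(1 / M)) * Real.exp (S.card * (η * m / M)) := by
  have hη1 : (0 : ℝ) < 1 + η := by linarith
  have hprod : ∀ B : J → Ω, 0 ≤ ∏ j, q (B j) := fun B => Finset.prod_nonneg fun j _ => hq.1 _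
  have hmgf : ∑ w, q w * (1 + η) ^ (f w / M) ≤ Real.exp (η * m / M) := by
    calc ∑ w, q w * (1 + η) ^ (f w / M)
        ≤ ∑ w, (q w + η / M * (q w * f w)) := by
          refine Finset.sum_le_sum fun w _ => ?_
          have h := rpow_one_add_le_one_add_mul_self (s := η) (by linarith)
            (div_nonneg (hf w) hM.le) ((div_le_one hM).2 (hfM w))
          calc q w * (1 + η) ^ (f w / M) ≤ q w * (1 + f w / M * η) :=
                mul_le_mul_of_nonneg_left h (hq.1 w)
            _ = _ := by ring
      _ = 1 + η / M * ∑ w, q w * f w := by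
          rw [Finset.sum_add_distrib, hq.2, Finset.mul_sum]
      _ ≤ η / M * m + 1 := by
          have := mul_le_mul_of_nonneg_left hm (div_pos hη hM).le
          linarith
      _ = η * m / M + 1 := by ring
      _ ≤ _ := Real.add_one_le_exp _
  calc ∑ B ∈ Finset.univ.filter (fun B : J → Ω => 1 < ∑ j ∈ S, f (B j)), ∏ j, q (B j)
      ≤ ∑ B ∈ Finset.univ.filter (fun B : J → Ω => 1 < ∑ j ∈ S, f (B j)),
          (1 + η) ^ (-(1 / M)) * ∏ j, q (B j) * (if j ∈ S then (1 + η) ^ (f (B j) / M) else 1) := by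
        refine Finset.sum_le_sum fun B hB => ?_
        have hB' := (Finset.mem_filter.1 hB).2
        have hpow : ∏ j ∈ S, (1 + η) ^ (f (B j) / M) = (1 + η) ^ ((∑ j ∈ S, f (B j)) / M) := by
          rw [Finset.sum_div, Real.rpow_sum_of_pos hη1]
        rw [Finset.prod_mul_distrib, Finset.prod_ite_mem, Finset.univ_inter, hpow,
          mul_left_comm, ← Real.rpow_add hη1]
        refine le_mul_of_one_le_right (hprod B) (Real.one_le_rpow (by linarith) ?_)
        have : 1 / M ≤ (∑ j ∈ S, f (B j)) / M := by gcongr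
        linarith
    _ ≤ ∑ B : J → Ω,
          (1 + η) ^ (-(1 / M)) * ∏ j, q (B j) * (if j ∈ S then (1 + η) ^ (f (B j) / M) else 1) := by
        refine Finset.sum_le_sum_of_subset_of_nonneg (Finset.filter_subset _ _) fun B _ _ => ?_
        refine mul_nonneg (Real.rpow_nonneg hη1.le _) (Finset.prod_nonneg fun j _ => ?_)
        refine mul_nonneg (hq.1 _) ?_
        split_ifs
        · exact Real.rpow_nonneg hη1.le _
        · exact zero_le_one
    _ = (1 + η) ^ (-(1 / M)) *
          ∏ j, ∑ w, q w * (if j ∈ S then (1 + η) ^ (f w / M) else 1) := by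
        rw [← Finset.mul_sum,
          Fintype.prod_sum fun j w => q w * (if j ∈ S then (1 + η) ^ (f w / M) else 1)]
    _ = (1 + η) ^ (-(1 / M)) * (∑ w, q w * (1 + η) ^ (f w / M)) ^ S.card := by
        congr 1
        have : ∀ j, ∑ w, q w * (if j ∈ S then (1 + η) ^ (f w / M) else 1)
            = if j ∈ S then ∑ w, q w * (1 + η) ^ (f w / M) else 1 := by
          intro j
          split_ifs
          · rfl
          · simpa using hq.2
        simp_rw [this]
        rw [Finset.prod_ite_mem, Finset.univ_inter, Finset.prod_const]
    _ ≤ (1 + η) ^ (-(1 / M)) * Real.exp (S.card * (η * m / M)) := by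
        rw [Real.exp_nat_mul]
        refine mul_le_mul_of_nonneg_left (pow_le_pow_left₀ ?_ hmgf _) (Real.rpow_nonneg hη1.le _)
        exact Finset.sum_nonneg fun w _ => mul_nonneg (hq.1 w) (Real.rpow_nonneg hη1.le _)

lemma sum_prod_eq_prod_sum {α J : Type*} [Fintype α] [Fintype J] [DecidableEq J]
    (f : J → α → ℝ) : ∑ x : J → α, ∏ i, f i (x i) = ∏ i, ∑ a, f i a :=
  (Fintype.prod_sum f).symm

lemma IsPMF.push {α β : Type*} [Fintype α] [Fintype β] {p : α → ℝ} (hp : IsPMF p) (f : α → β) :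
    IsPMF (push p f) := by
  refine ⟨fun b => Finset.sum_nonneg fun a _ => ?_, ?_⟩
  · split_ifs
    · exact hp.1 a
    · exact le_rfl
  · unfold _root_.push
    rw [Finset.sum_comm, ← hp.2]
    simp

lemma push_fst_apply {α β : Type*} [Fintype α] [Fintype β] (p : α × β → ℝ) (a : α) :
    push p Prod.fst a = ∑ b, p (a, b) := by
  unfold push
  rw [Fintype.sum_prod_type, Finset.sum_comm]
  simp

lemma push_snd_apply {α β : Type*} [Fintype α] [Fintype β] (p : α × β → ℝ) (b : β) :
    push p Prod.snd b = ∑ a, p (a, b) := by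
  unfold push
  rw [Fintype.sum_prod_type]
  simp

lemma IsPMF.le_push_fst {α β : Type*} [Fintype α] [Fintype β] {p : α × β → ℝ} (hp : IsPMF p)
    (z : α × β) : p z ≤ _root_.push p Prod.fst z.1 := by
  rw [push_fst_apply]
  exact Finset.single_le_sum (f := fun b => p (z.1, b)) (fun b _ => hp.1 _) (Finset.mem_univ z.2)

lemma IsPMF.le_push_snd {α β : Type*} [Fintype α] [Fintype β] {p : α × β → ℝ} (hp : IsPMF p)
    (z : α × β) : p z ≤ _root_.push p Prod.snd z.2 := by
  rw [push_snd_apply]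
  exact Finset.single_le_sum (f := fun a => p (a, z.2)) (fun b _ => hp.1 _) (Finset.mem_univ z.1)

/-- The information density ratio `p(a,b) / (p(a) p(b))`. -/
def infoRatio {α β : Type*} [Fintype α] [Fintype β] (p : α × β → ℝ) (z : α × β) : ℝ :=
  p z / push p Prod.snd z.2 / push p Prod.fst z.1

lemma IsPMF.infoRatio_pos {α β : Type*} [Fintype α] [Fintype β] {p : α × β → ℝ} (hp : IsPMF p)
    {z : α × β} (hz : 0 < p z) : 0 < infoRatio p z :=
  div_pos (div_pos hz (hz.trans_le (hp.le_push_snd z))) (hz.trans_le (hp.le_push_fst z))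

lemma IsPMF.I2_eq_sum {α β : Type*} [Fintype α] [Fintype β] {p : α × β → ℝ} (hp : IsPMF p) :
    I2 p = ∑ z, p z * Real.logb 2 (infoRatio p z) := by
  have h1 : Hent (_root_.push p Prod.fst)
      = ∑ z, -(p z * Real.logb 2 (_root_.push p Prod.fst z.1)) := by
    rw [Fintype.sum_prod_type]
    refine Finset.sum_congr rfl fun a _ => ?_
    simp only []
    rw [Finset.sum_neg_distrib, ← Finset.sum_mul, ← push_fst_apply]
  have h2 : Hent (_root_.push p Prod.snd)
      = ∑ z, -(p z * Real.logb 2 (_root_.push p Prod.snd z.2)) := by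
    rw [Fintype.sum_prod_type_right]
    refine Finset.sum_congr rfl fun a _ => ?_
    simp only []
    rw [Finset.sum_neg_distrib, ← Finset.sum_mul, ← push_snd_apply]
  rw [I2, h1, h2, Hent, ← Finset.sum_add_distrib, ← Finset.sum_sub_distrib]
  refine Finset.sum_congr rfl fun z _ => ?_
  rcases (hp.1 z).eq_or_lt with h | h
  · simp [← h]
  · have hs := h.trans_le (hp.le_push_snd z)
    have hf := h.trans_le (hp.le_push_fst z)
    rw [infoRatio, Real.logb_div (div_pos h hs).ne' hf.ne', Real.logb_div h.ne' hs.ne']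
    ring

lemma pos_of_mem_Typ {α : Type*} [Fintype α] {q : α → ℝ} (hq : IsPMF q) {δ : ℝ} {n : ℕ}
    {x : Fin n → α} (hx : x ∈ Typ q δ n) (i : Fin n) : 0 < q (x i) := by
  refine (hq.1 _).lt_of_ne fun h => ?_
  have hx' := (Finset.mem_filter.1 hx).2 (x i)
  rw [← h, mul_zero, sub_zero] at hx'
  have h0 : empir x (x i) = 0 := abs_nonpos_iff.1 hx'
  have hn : (n : ℝ) ≠ 0 := by
    have := i.pos
    positivity
  rw [empir, div_eq_zero_iff, or_iff_left hn, Nat.cast_eq_zero, Finset.card_eq_zero] at h0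
  exact Finset.filter_eq_empty_iff.1 h0 (Finset.mem_univ i) rfl

lemma sum_comp_eq_mul_sum_empir {α : Type*} [Fintype α] {n : ℕ} (x : Fin n → α) (g : α → ℝ) :
    ∑ i, g (x i) = n * ∑ a, empir x a * g a := by
  rcases Nat.eq_zero_or_pos n with rfl | hn
  · simp
  have hn' : (n : ℝ) ≠ 0 := by positivity
  rw [← Finset.sum_fiberwise Finset.univ x (fun i => g (x i)), Finset.mul_sum]
  refine Finset.sum_congr rfl fun a _ => ?_
  rw [Finset.sum_congr rfl (g := fun _ => g a)
    (fun i hi => by rw [(Finset.mem_filter.1 hi).2]), Finset.sum_const, nsmul_eq_mul, empir]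
  field_simp

/-- Weighted typical-average bound for a sequence in the typical set. -/
lemma sum_empir_mul_le {α : Type*} [Fintype α] {q : α → ℝ} {δ : ℝ} {n : ℕ}
    {x : Fin n → α} (hx : x ∈ Typ q δ n) (g : α → ℝ) :
    ∑ a, empir x a * g a ≤ ∑ a, q a * g a + δ * ∑ a, q a * |g a| := by
  rw [Finset.mul_sum, ← Finset.sum_add_distrib]
  refine Finset.sum_le_sum fun a _ => ?_
  have h := mul_le_mul_of_nonneg_right ((Finset.mem_filter.1 hx).2 a) (abs_nonneg (g a))
  rw [← abs_mul] at h
  linarith [le_abs_self ((empir x a - q a) * g a)]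

lemma IsPMF.prod_infoRatio_le {α β : Type*} [Fintype α] [Fintype β] {p : α × β → ℝ}
    (hp : IsPMF p) {δ : ℝ} {n : ℕ} {z : Fin n → α × β} (hz : z ∈ Typ p δ n) :
    ∏ i, infoRatio p (z i)
      ≤ (2 : ℝ) ^ (n * (I2 p + δ * ∑ z, p z * |Real.logb 2 (infoRatio p z)|)) := by
  have hpos : ∀ i, 0 < infoRatio p (z i) := fun i => hp.infoRatio_pos (pos_of_mem_Typ hp hz i)
  have : ∏ i, infoRatio p (z i) = (2 : ℝ) ^ (∑ i, Real.logb 2 (infoRatio p (z i))) := by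
    rw [Real.rpow_sum_of_pos two_pos]
    exact Finset.prod_congr rfl fun i _ =>
      (Real.rpow_logb two_pos (by norm_num) (hpos i)).symm
  rw [this, sum_comp_eq_mul_sum_empir z (fun z => Real.logb 2 (infoRatio p z)), hp.I2_eq_sum]
  refine Real.rpow_le_rpow_of_exponent_le one_le_two ?_
  exact mul_le_mul_of_nonneg_left (sum_empir_mul_le hz _) n.cast_nonneg

lemma exists_card_fiber_eq {α : Type*} [Fintype α] {n : ℕ} (k : α → ℕ) (hk : ∑ a, k a = n) :
    ∃ x : Fin n → α, ∀ a, (Finset.univ.filter fun i => x i = a).card = k a := by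
  have e : (Σ a, Fin (k a)) ≃ Fin n := Fintype.equivOfCardEq (by simp [hk])
  refine ⟨fun i => (e.symm i).1, fun a => ?_⟩
  rw [Finset.card_filter, Equiv.sum_comp e.symm (fun s => if s.1 = a then 1 else 0),
    Fintype.sum_sigma]
  simp [apply_ite Finset.card]

/-- A PMF can be approximated by integer counts summing to `n` with bounded error. -/
lemma IsPMF.exists_counts {α : Type*} [Fintype α] {q : α → ℝ} (hq : IsPMF q) (n : ℕ) :
    ∃ k : α → ℕ, ∑ a, k a = n ∧ (∀ a, |(k a : ℝ) - n * q a| ≤ Fintype.card α) ∧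
      ∀ a, q a = 0 → k a = 0 := by
  obtain ⟨a₀, ha₀⟩ : ∃ a, q a ≠ 0 := by
    by_contra! h
    simpa [h] using hq.2
  set s : Finset α := Finset.univ.erase a₀
  have hsum : ∀ g : α → ℝ, ∑ a, g a = g a₀ + ∑ a ∈ s, g a := fun g =>
    (Finset.add_sum_erase _ g (Finset.mem_univ a₀)).symm
  have hnq : ∀ a, 0 ≤ n * q a := fun a => mul_nonneg n.cast_nonneg (hq.1 a)
  have hfl : ∀ a, (⌊n * q a⌋₊ : ℝ) ≤ n * q a := fun a => Nat.floor_le (hnq a)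
  have hfl' : ∀ a, n * q a - 1 ≤ (⌊n * q a⌋₊ : ℝ) := fun a => (Nat.sub_one_lt_floor _).le
  have hq1 : n * q a₀ + ∑ a ∈ s, n * q a = n := by
    rw [← hsum (fun a => n * q a), ← Finset.mul_sum, hq.2, mul_one]
  have hle : (∑ a ∈ s, (⌊n * q a⌋₊ : ℝ)) ≤ ∑ a ∈ s, n * q a :=
    Finset.sum_le_sum fun a _ => hfl a
  have hge : ∑ a ∈ s, n * q a - Fintype.card α ≤ ∑ a ∈ s, (⌊n * q a⌋₊ : ℝ) := by
    have h := Finset.sum_le_sum fun a (_ : a ∈ s) => hfl' a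
    rw [Finset.sum_sub_distrib] at h
    have hc : (s.card : ℝ) ≤ Fintype.card α := by exact_mod_cast Finset.card_le_univ s
    simp only [Finset.sum_const, nsmul_eq_mul, mul_one] at h
    linarith
  have hleN : ∑ a ∈ s, ⌊n * q a⌋₊ ≤ n := by
    have : (∑ a ∈ s, (⌊n * q a⌋₊ : ℝ)) ≤ n := by linarith [hnq a₀]
    exact_mod_cast this
  have hcard : (1 : ℝ) ≤ Fintype.card α := by
    exact_mod_cast Fintype.card_pos_iff.2 ⟨a₀⟩
  refine ⟨fun a => if a = a₀ then n - ∑ b ∈ s, ⌊n * q b⌋₊ else ⌊n * q a⌋₊, ?_, ?_, ?_⟩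
  · rw [← Finset.add_sum_erase _ _ (Finset.mem_univ a₀), if_pos rfl,
      Finset.sum_congr rfl fun a ha => if_neg (Finset.ne_of_mem_erase ha)]
    exact Nat.sub_add_cancel hleN
  · intro a
    simp only []
    split_ifs with h
    · subst h
      rw [Nat.cast_sub hleN, Nat.cast_sum, abs_le]
      constructor <;> linarith
    · rw [abs_le]
      constructor <;> linarith [hfl a, hfl' a]
  · intro a ha
    have : a ≠ a₀ := by
      rintro rfl
      exact ha₀ ha
    simp [this, ha]

lemma IsPMF.eventually_Typ_nonempty {α : Type*} [Fintype α] {q : α → ℝ} (hq : IsPMF q)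
    {δ : ℝ} (hδ : 0 < δ) : ∀ᶠ n in Filter.atTop, (Typ q δ n).Nonempty := by
  have hlarge : ∀ᶠ n : ℕ in Filter.atTop, ∀ a, q a ≠ 0 → (Fintype.card α : ℝ) ≤ n * (δ * q a) := by
    refine Filter.eventually_all.2 fun a => ?_
    by_cases h : q a = 0
    · simp [h]
    have hpos : 0 < δ * q a := mul_pos hδ ((hq.1 a).lt_of_ne' h)
    filter_upwards [(tendsto_natCast_atTop_atTop.atTop_mul_const hpos).eventually_ge_atTop
      (Fintype.card α : ℝ)] with n hn _ using hn
  filter_upwards [hlarge, Filter.eventually_gt_atTop 0] with n hn hn0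
  obtain ⟨k, hk, hkq, hk0⟩ := hq.exists_counts n
  obtain ⟨x, hx⟩ := exists_card_fiber_eq k hk
  have hn0' : (0 : ℝ) < n := by exact_mod_cast hn0
  refine ⟨x, Finset.mem_filter.2 ⟨Finset.mem_univ _, fun a => ?_⟩⟩
  rw [empir, hx]
  by_cases h : q a = 0
  · simp [h, hk0 a h]
  · have : (k a : ℝ) / n - q a = (k a - n * q a) / n := by field_simp
    rw [this, abs_div, abs_of_pos hn0', div_le_iff₀ hn0']
    linarith [hkq a, hn a h]

lemma IsPMF.eventually_prunedMass_pos {α : Type*} [Fintype α] {q : α → ℝ} (hq : IsPMF q)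
    {δ : ℝ} (hδ : 0 < δ) : ∀ᶠ n in Filter.atTop, 0 < prunedMass q δ n := by
  filter_upwards [hq.eventually_Typ_nonempty hδ] with n hn
  exact Finset.sum_pos (fun x hx => Finset.prod_pos fun i _ => pos_of_mem_Typ hq hx i) hn

lemma IsPMF.prunedMass_nonneg {α : Type*} [Fintype α] {q : α → ℝ} (hq : IsPMF q)
    (δ : ℝ) (n : ℕ) : 0 ≤ prunedMass q δ n :=
  Finset.sum_nonneg fun _ _ => Finset.prod_nonneg fun _ _ => hq.1 _

lemma IsPMF.prunedMass_le_one {α : Type*} [Fintype α] {q : α → ℝ} (hq : IsPMF q)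
    (δ : ℝ) (n : ℕ) : prunedMass q δ n ≤ 1 := by
  calc prunedMass q δ n ≤ ∑ x : Fin n → α, ∏ i, q (x i) :=
        Finset.sum_le_sum_of_subset_of_nonneg (Finset.subset_univ _)
          fun _ _ _ => Finset.prod_nonneg fun _ _ => hq.1 _
    _ = 1 := by
        rw [sum_prod_eq_prod_sum (fun _ => q)]
        simp [hq.2]

lemma IsPMF.pruned {α : Type*} [Fintype α] {q : α → ℝ} (hq : IsPMF q) {δ : ℝ} {n : ℕ}
    (h : 0 < prunedMass q δ n) : IsPMF (pruned q δ n) := by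
  refine ⟨fun x => ?_, ?_⟩
  · unfold _root_.pruned
    split_ifs
    · exact div_nonneg (Finset.prod_nonneg fun _ _ => hq.1 _) h.le
    · exact le_rfl
  · unfold _root_.pruned
    rw [Finset.sum_ite_mem, Finset.univ_inter, ← Finset.sum_div]
    exact div_self h.ne'

lemma sum_biUnion_le_sum_sum {ι κ : Type*} [DecidableEq κ] (s : Finset ι) (t : ι → Finset κ)
    {f : κ → ℝ} (hf : ∀ b, 0 ≤ f b) : ∑ b ∈ s.biUnion t, f b ≤ ∑ i ∈ s, ∑ b ∈ t i, f b := by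
  induction s using Finset.induction_on with
  | empty => simp
  | insert i s hi ih =>
    rw [Finset.biUnion_insert, Finset.sum_insert hi]
    have h := Finset.sum_union_inter (s₁ := t i) (s₂ := s.biUnion t) (f := f)
    linarith [Finset.sum_nonneg fun b (_ : b ∈ t i ∩ s.biUnion t) => hf b]

section Encoder

variable {X W : Type} [Fintype X] [Fintype W] {p : X × W → ℝ} {η δ : ℝ} {n L : ℕ}

lemma Eenc_nonneg (hp : IsPMF p) (hη : 0 < η) (w : Fin n → W) (x : Fin n → X) :
    0 ≤ Eenc p (1 - prunedMass (push p Prod.snd) δ n) η δ n L w x := by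
  unfold Eenc
  split_ifs
  · rw [sub_sub_cancel]
    have h1 := (hp.push Prod.snd).prunedMass_nonneg δ n
    have h2 : 0 ≤ ∏ i, p (x i, w i) / push p Prod.snd (w i) :=
      Finset.prod_nonneg fun i _ => div_nonneg (hp.1 _) ((hp.push Prod.snd).1 _)
    have h3 : 0 ≤ ∏ i, push p Prod.fst (x i) :=
      Finset.prod_nonneg fun i _ => (hp.push Prod.fst).1 _
    positivity
  · exact le_rfl

lemma Eenc_le (hp : IsPMF p) (hη : 0 < η) (w : Fin n → W) (x : Fin n → X) :
    Eenc p (1 - prunedMass (push p Prod.snd) δ n) η δ n L w x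
      ≤ (2 : ℝ) ^ (n * (I2 p + δ * ∑ z, p z * |Real.logb 2 (infoRatio p z)|)) / L := by
  unfold Eenc
  split_ifs with h
  · have hr := hp.prod_infoRatio_le h
    have hpos : 0 ≤ ∏ i, infoRatio p (x i, w i) :=
      Finset.prod_nonneg fun i _ => (hp.infoRatio_pos (pos_of_mem_Typ hp h i)).le
    have hm : prunedMass (push p Prod.snd) δ n / (1 + η) ≤ 1 := by
      rw [div_le_one (by linarith)]
      linarith [(hp.push Prod.snd).prunedMass_le_one δ n]
    calc _ = prunedMass (push p Prod.snd) δ n / (1 + η) * (∏ i, infoRatio p (x i, w i)) / L := by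
          simp only [infoRatio, Finset.prod_div_distrib]
          generalize 1 + η = t
          ring
      _ ≤ _ := by
          refine div_le_div_of_nonneg_right ?_ L.cast_nonneg
          exact (mul_le_of_le_one_left hpos hm).trans hr
  · positivity

lemma sum_pruned_mul_Eenc_le (hp : IsPMF p) (hη : 0 < η) (x : Fin n → X) :
    ∑ w, pruned (push p Prod.snd) δ n w *
        Eenc p (1 - prunedMass (push p Prod.snd) δ n) η δ n L w x
      ≤ 1 / ((1 + η) * L) := by
  have hX : 0 ≤ ∏ i, push p Prod.fst (x i) :=
    Finset.prod_nonneg fun i _ => (hp.push Prod.fst).1 _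
  have hterm : ∀ w : Fin n → W, pruned (push p Prod.snd) δ n w *
      Eenc p (1 - prunedMass (push p Prod.snd) δ n) η δ n L w x
      ≤ (∏ i, p (x i, w i)) / ((1 + η) * L * ∏ i, push p Prod.fst (x i)) := by
    intro w
    have hnum : 0 ≤ ∏ i, p (x i, w i) := Finset.prod_nonneg fun i _ => hp.1 _
    have hR : 0 ≤ (∏ i, p (x i, w i)) / ((1 + η) * L * ∏ i, push p Prod.fst (x i)) := by
      positivity
    unfold pruned Eenc
    split_ifs
    · have hPR : (∏ i, push p Prod.snd (w i)) * ∏ i, p (x i, w i) / push p Prod.snd (w i)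
          ≤ ∏ i, p (x i, w i) := by
        rw [← Finset.prod_mul_distrib]
        refine Finset.prod_le_prod (fun i _ => ?_) fun i _ => ?_
        · exact mul_nonneg ((hp.push _).1 _) (div_nonneg (hp.1 _) ((hp.push _).1 _))
        · rw [mul_div_left_comm]
          exact mul_le_of_le_one_right (hp.1 _) (div_self_le_one _)
      have hPR0 : 0 ≤ (∏ i, push p Prod.snd (w i)) *
          ∏ i, p (x i, w i) / push p Prod.snd (w i) :=
        mul_nonneg (Finset.prod_nonneg fun i _ => (hp.push _).1 _)
          (Finset.prod_nonneg fun i _ => div_nonneg (hp.1 _) ((hp.push _).1 _))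
      calc _ = (prunedMass (push p Prod.snd) δ n / prunedMass (push p Prod.snd) δ n) *
            ((∏ i, push p Prod.snd (w i)) * ∏ i, p (x i, w i) / push p Prod.snd (w i)) /
              ((1 + η) * L * ∏ i, push p Prod.fst (x i)) := by ring
        _ ≤ _ := by
            refine div_le_div_of_nonneg_right ?_ (by positivity)
            exact (mul_le_of_le_one_left hPR0 (div_self_le_one _)).trans hPR
    all_goals simpa using hR
  refine (Finset.sum_le_sum fun w _ => hterm w).trans ?_
  rw [← Finset.sum_div, sum_prod_eq_prod_sum (fun i b => p (x i, b))]
  simp_rw [← push_fst_apply]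
  calc (∏ i, push p Prod.fst (x i)) / ((1 + η) * L * ∏ i, push p Prod.fst (x i))
      = (∏ i, push p Prod.fst (x i)) / (∏ i, push p Prod.fst (x i)) * (1 / ((1 + η) * L)) := by
        generalize 1 + η = t
        ring
    _ ≤ _ := mul_le_of_le_one_left (by positivity) (div_self_le_one _)

/-- For one message index and one source sequence, the encoder weights fail to be
sub-normalized with doubly exponentially small probability. -/
lemma sum_filter_one_lt_Eenc_le (hp : IsPMF p) (hη : 0 < η) (hL : 0 < L) {N : ℕ}
    (hmass : 0 < prunedMass (push p Prod.snd) δ n) (μ : Fin N) (x : Fin n → X) :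
    ∑ B ∈ Finset.univ.filter (fun B : Fin L × Fin N → (Fin n → W) =>
        1 < ∑ l, Eenc p (1 - prunedMass (push p Prod.snd) δ n) η δ n L (B (l, μ)) x),
      ∏ j, pruned (push p Prod.snd) δ n (B j)
      ≤ Real.exp (-((Real.log (1 + η) - η / (1 + η)) *
        (L / (2 : ℝ) ^ (n * (I2 p + δ * ∑ z, p z * |Real.logb 2 (infoRatio p z)|))))) := by
  set M : ℝ := (2 : ℝ) ^ (n * (I2 p + δ * ∑ z, p z * |Real.logb 2 (infoRatio p z)|))
  have hM : 0 < M := by positivity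
  have hL' : (0 : ℝ) < L := by exact_mod_cast hL
  have h := sum_filter_one_lt_prod_le ((hp.push Prod.snd).pruned hmass)
    ((Finset.univ : Finset (Fin L)) ×ˢ ({μ} : Finset (Fin N))) (div_pos hM hL') hη
    (fun w => Eenc_nonneg hp hη w x) (fun w => Eenc_le hp hη w x)
    (sum_pruned_mul_Eenc_le hp hη x)
  simp only [Finset.sum_product, Finset.sum_singleton, Finset.card_product, Finset.card_univ,
    Fintype.card_fin, Finset.card_singleton, mul_one] at h
  refine h.trans (le_of_eq ?_)
  rw [Real.rpow_def_of_pos (by linarith), ← Real.exp_add]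
  congr 1
  have : (1 + η) ≠ 0 := by linarith
  field_simp
  ring

end Encoder

lemma log_one_add_sub_pos {η : ℝ} (hη : 0 < η) : 0 < Real.log (1 + η) - η / (1 + η) := by
  have h1 : (0 : ℝ) < 1 + η := by linarith
  have h := Real.add_one_lt_exp (x := Real.log (1 + η)⁻¹)
    (Real.log_ne_zero_of_pos_of_ne_one (by positivity) (by
      rw [ne_eq, inv_eq_one]
      linarith))
  rw [Real.exp_log (by positivity), Real.log_inv] at h
  have : η / (1 + η) = 1 - (1 + η)⁻¹ := by field_simp; ring
  linarith

/-- A doubly exponential decay beats any exponential growth. -/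
lemma tendsto_pow_mul_exp_neg_mul_pow {a b c : ℝ} (ha : 0 ≤ a) (hb : 1 < b) (hc : 0 < c) :
    Filter.Tendsto (fun n : ℕ => a ^ n * Real.exp (-(c * b ^ n))) Filter.atTop (nhds 0) := by
  have hlim := tendsto_pow_const_div_const_pow_of_one_lt 1 hb
  have hev : ∀ᶠ n : ℕ in Filter.atTop, (n : ℝ) ^ 1 / b ^ n < c / (a + 1) :=
    hlim.eventually_lt_const (by positivity)
  have hexp : Filter.Tendsto (fun n : ℕ => Real.exp (-(n : ℝ))) Filter.atTop (nhds 0) :=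
    Real.tendsto_exp_neg_atTop_nhds_zero.comp tendsto_natCast_atTop_atTop
  refine squeeze_zero' (.of_forall fun n => by positivity) ?_ hexp
  filter_upwards [hev] with n hn
  rw [pow_one, div_lt_div_iff₀ (by positivity) (by positivity)] at hn
  calc a ^ n * Real.exp (-(c * b ^ n)) ≤ Real.exp a ^ n * Real.exp (-(c * b ^ n)) := by
        gcongr
        linarith [Real.add_one_le_exp a]
    _ = Real.exp (n * a - c * b ^ n) := by
        rw [← Real.exp_nat_mul, ← Real.exp_add, sub_eq_add_neg]
    _ ≤ Real.exp (-(n : ℝ)) := Real.exp_le_exp.2 (by linarith)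

/-- **Lemma 3 (the encoder is sub-normalized with high probability).**
Let `p` be a joint PMF on `𝒳 × 𝒲`, `C ≥ 0`, and draw a codebook of codewords
`w^n(l,μ)`, `l ∈ [⌈2^{nR̃}⌉]`, `μ ∈ [⌈2^{nC}⌉]`, i.i.d. from the pruned distribution.
With `ε := 1 − p^n_W(T_δ(W))`, there is a `δ₁ > 0` depending only on `δ` (and `p`),
with `δ₁ → 0` as `δ → 0`, such that whenever `R̃ > I(X;W) + 4δ₁`, the probability that
`Σ_l E^{(μ)}_{L|X^n}(l|x^n) ≤ 1` holds for every `μ` and every `δ`-typical `x^n`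
tends to `1` as `n → ∞`. -/
theorem statement5 {X W : Type} [Fintype X] [Fintype W]
    (p : X × W → ℝ) (hp : IsPMF p) :
    ∃ d1 : ℝ → ℝ,
      (∀ δ : ℝ, 0 < δ → δ < 1 → 0 < d1 δ) ∧
      Filter.Tendsto d1 (nhdsWithin 0 (Set.Ioi 0)) (nhds 0) ∧
      ∀ δ η C Rt : ℝ, 0 < δ → δ < 1 → 0 < η → η < 1 → 0 ≤ C → 0 < Rt →
        I2 p + 4 * d1 δ < Rt →
        Filter.Tendsto
          (fun n : ℕ =>
            ∑ B ∈ Finset.univ.filter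
              (fun B : Fin (NC n Rt) × Fin (NC n C) → (Fin n → W) =>
                ∀ μ : Fin (NC n C), ∀ xn ∈ Typ (push p Prod.fst) δ n,
                  (∑ l : Fin (NC n Rt),
                    Eenc p (1 - prunedMass (push p Prod.snd) δ n) η δ n (NC n Rt)
                      (B (l, μ)) xn) ≤ 1),
              ∏ j : Fin (NC n Rt) × Fin (NC n C), pruned (push p Prod.snd) δ n (B j))
          Filter.atTop (nhds 1) := by
  set K : ℝ := ∑ z, p z * |Real.logb 2 (infoRatio p z)|
  have hK : 0 ≤ K := Finset.sum_nonneg fun z _ => mul_nonneg (hp.1 z) (abs_nonneg _)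
  refine ⟨fun δ => δ * (K + 1), fun δ hδ _ => by positivity, ?_, ?_⟩
  · have h : Filter.Tendsto (fun δ : ℝ => δ * (K + 1)) (nhds 0) (nhds (0 * (K + 1))) :=
      Filter.tendsto_id.mul_const _
    rw [zero_mul] at h
    exact h.mono_left nhdsWithin_le_nhds
  intro δ η C Rt hδ _ hη _ hC _ hR
  set γ : ℝ := Rt - (I2 p + δ * K)
  have hγ : 0 < γ := by
    have : 0 ≤ δ * K := mul_nonneg hδ.le hK
    simp only [γ]
    nlinarith
  set c : ℝ := Real.log (1 + η) - η / (1 + η)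
  have hc : 0 < c := log_one_add_sub_pos hη
  have herr : Filter.Tendsto (fun n : ℕ => 2 * (((2 : ℝ) ^ C * Fintype.card X) ^ n *
      Real.exp (-(c * ((2 : ℝ) ^ γ) ^ n)))) Filter.atTop (nhds 0) := by
    simpa using (tendsto_pow_mul_exp_neg_mul_pow (a := (2 : ℝ) ^ C * Fintype.card X)
      (by positivity) (Real.one_lt_rpow one_lt_two hγ) hc).const_mul 2
  have hlow := herr.const_sub 1
  rw [sub_zero] at hlow
  refine tendsto_of_tendsto_of_tendsto_of_le_of_le' hlow tendsto_const_nhds ?_ ?_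
  all_goals
    filter_upwards [(hp.push Prod.snd).eventually_prunedMass_pos hδ] with n hmass
    have hq := (hp.push Prod.snd).pruned hmass
    have hprod : ∀ B : Fin (NC n Rt) × Fin (NC n C) → (Fin n → W),
        0 ≤ ∏ j, pruned (push p Prod.snd) δ n (B j) :=
      fun B => Finset.prod_nonneg fun j _ => hq.1 _
    have htotal : ∑ B : Fin (NC n Rt) × Fin (NC n C) → (Fin n → W),
        ∏ j, pruned (push p Prod.snd) δ n (B j) = 1 := by
      rw [sum_prod_eq_prod_sum (fun _ => pruned (push p Prod.snd) δ n)]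
      simp [hq.2]
  · have hNC : (NC n C : ℝ) ≤ 2 * ((2 : ℝ) ^ C) ^ n := by
      have h1 := Nat.ceil_lt_add_one (a := (2 : ℝ) ^ ((n : ℝ) * C)) (by positivity)
      have h2 : (1 : ℝ) ≤ (2 : ℝ) ^ ((n : ℝ) * C) :=
        Real.one_le_rpow one_le_two (mul_nonneg n.cast_nonneg hC)
      rw [← Real.rpow_natCast, ← Real.rpow_mul zero_le_two, mul_comm C, NC]
      linarith
    have hRt : (2 : ℝ) ^ (n * Rt) ≤ NC n Rt := Nat.le_ceil _
    have hL : 0 < NC n Rt := by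
      have : (0 : ℝ) < NC n Rt := lt_of_lt_of_le (by positivity) hRt
      exact_mod_cast this
    have hexp : ((2 : ℝ) ^ γ) ^ n ≤ NC n Rt / (2 : ℝ) ^ (n * (I2 p + δ * K)) := by
      rw [le_div_iff₀ (by positivity), ← Real.rpow_natCast, ← Real.rpow_mul zero_le_two,
        ← Real.rpow_add two_pos]
      refine le_trans (le_of_eq ?_) hRt
      congr 1
      simp only [γ]
      ring
    have hsplit := Finset.sum_filter_add_sum_filter_not Finset.univ
      (fun B : Fin (NC n Rt) × Fin (NC n C) → (Fin n → W) =>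
        ∀ μ : Fin (NC n C), ∀ xn ∈ Typ (push p Prod.fst) δ n,
          (∑ l : Fin (NC n Rt),
            Eenc p (1 - prunedMass (push p Prod.snd) δ n) η δ n (NC n Rt) (B (l, μ)) xn) ≤ 1)
      (fun B => ∏ j, pruned (push p Prod.snd) δ n (B j))
    rw [htotal] at hsplit
    refine sub_le_iff_le_add.2 (hsplit.symm.le.trans (add_le_add le_rfl ?_))
    calc _ ≤ ∑ B ∈ Finset.univ.biUnion fun y : Fin (NC n C) × (Fin n → X) =>
          Finset.univ.filter (fun B : Fin (NC n Rt) × Fin (NC n C) → (Fin n → W) =>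
            1 < ∑ l, Eenc p (1 - prunedMass (push p Prod.snd) δ n) η δ n (NC n Rt)
              (B (l, y.1)) y.2),
            ∏ j, pruned (push p Prod.snd) δ n (B j) := by
          refine Finset.sum_le_sum_of_subset_of_nonneg (fun B hB => ?_) fun B _ _ => hprod B
          have hB' := (Finset.mem_filter.1 hB).2
          push Not at hB'
          obtain ⟨μ, x, _, hx⟩ := hB'
          exact Finset.mem_biUnion.2
            ⟨(μ, x), Finset.mem_univ _, Finset.mem_filter.2 ⟨Finset.mem_univ _, hx⟩⟩
      _ ≤ ∑ y : Fin (NC n C) × (Fin n → X), ∑ B ∈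
          Finset.univ.filter (fun B : Fin (NC n Rt) × Fin (NC n C) → (Fin n → W) =>
            1 < ∑ l, Eenc p (1 - prunedMass (push p Prod.snd) δ n) η δ n (NC n Rt)
              (B (l, y.1)) y.2),
            ∏ j, pruned (push p Prod.snd) δ n (B j) :=
          sum_biUnion_le_sum_sum _ _ hprod
      _ ≤ ∑ _y : Fin (NC n C) × (Fin n → X), Real.exp (-(c * ((2 : ℝ) ^ γ) ^ n)) := by
          refine Finset.sum_le_sum fun y _ =>
            (sum_filter_one_lt_Eenc_le hp hη hL hmass y.1 y.2).trans (Real.exp_le_exp.2 ?_)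
          exact neg_le_neg (mul_le_mul_of_nonneg_left hexp hc.le)
      _ = NC n C * (Fintype.card X : ℝ) ^ n * Real.exp (-(c * ((2 : ℝ) ^ γ) ^ n)) := by
          simp
      _ ≤ 2 * ((2 : ℝ) ^ C) ^ n * (Fintype.card X : ℝ) ^ n *
            Real.exp (-(c * ((2 : ℝ) ^ γ) ^ n)) := by gcongr
      _ = _ := by ring
  · exact (Finset.sum_le_sum_of_subset_of_nonneg (Finset.filter_subset _ _)
      fun B _ _ => hprod B).trans_eq htotal
end
end
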